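/- Fix an integer a ≥ 1. For every irrational x ∈ (0,1) and every j ≥ 0 with a_{j+1} > a, the mediant m_j := ((a_{j+1} − a) p_j + p_{j−1})/((a_{j+1} − a) q_j + q_{j−1}) satisfies a/(a+1) < Θ(x, m_j) < a + 1. Moreover, for Lebesgue-almost every irrational x ∈ (0,1) the set {j ≥ 0 : a_{j+1} > a} is infinite and, enumerating it increasingly as j_0 < j_1 < ⋯ and setting C := log((a+2)/(a+1)), for every z ∈ [a/(a+1), a+1] the limit lim_{n→∞} (1/n) · #{0 ≤ k < n : Θ(x, m_{j_k}) ≤ z} exists and equals: (1/C)·((a+1)z/a − 1 + log(a/((a+1)z))) for a/(a+1) ≤ z ≤ (a+1)/(a+2); (1/C)·(z/(a(a+1)) + log(a(a+2)/(a+1)²)) for (a+1)/(a+2) ≤ z ≤ a; (1/C)·(1 − z/(a+1) + log((a+2)z/(a+1)²)) for a ≤ z ≤ a+1. -/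

import Mathlib

open MeasureTheory Filter Topology
open scoped Classical

noncomputable section

/-- The Farey tent map `F`. -/
def fareyMap (x : ℝ) : ℝ := if x ≤ 1/2 then x / (1 - x) else (1 - x) / x

/-- `eps x n = ε_{n+1}(x)`, i.e. `0` if `F^[n] x ≤ 1/2` and `1` otherwise. -/
def eps (x : ℝ) (n : ℕ) : ℤ := if fareyMap^[n] x ≤ 1/2 then 0 else 1

/-- The matrices `A_0 = [[1,0],[1,1]]` and `A_1 = [[0,1],[1,1]]`. -/
def Amat (e : ℤ) : Matrix (Fin 2) (Fin 2) ℤ := !![1 - e, e; 1, 1]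

/-- `Mmat x n = A_{ε_1(x)} ⋯ A_{ε_n(x)}`, with `Mmat x 0` the identity. -/
def Mmat (x : ℝ) : ℕ → Matrix (Fin 2) (Fin 2) ℤ
  | 0 => 1
  | n + 1 => Mmat x n * Amat (eps x n)

/-- `u_n(x)`: top-left entry of `M_n(x)`. -/
def uF (x : ℝ) (n : ℕ) : ℤ := Mmat x n 0 0

/-- `s_n(x)`: bottom-left entry of `M_n(x)`. -/
def sF (x : ℝ) (n : ℕ) : ℤ := Mmat x n 1 0

/-- Ito's natural extension `F̄` of the Farey tent map. -/
def fareyNE (p : ℝ × ℝ) : ℝ × ℝ :=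
  if p.1 ≤ 1/2 then (p.1 / (1 - p.1), p.2 / (1 + p.2))
  else ((1 - p.1) / p.1, 1 / (1 + p.2))

/-- `Ω = [0,1]²`. -/
def OmegaSet : Set (ℝ × ℝ) := Set.Icc (0:ℝ) 1 ×ˢ Set.Icc (0:ℝ) 1

/-- The measure `μ̄` on `Ω` with density `(x + y − xy)⁻²` w.r.t. Lebesgue measure. -/
def muBar : Measure (ℝ × ℝ) :=
  (volume.restrict OmegaSet).withDensity
    (fun p => ENNReal.ofReal (1 / (p.1 + p.2 - p.1 * p.2) ^ 2))

/-- A proper inducible subregion of `Ω`. -/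
def ProperInducible (R : Set (ℝ × ℝ)) : Prop :=
  R ⊆ OmegaSet ∧ MeasurableSet R ∧ 0 < muBar R ∧ muBar R < ⊤ ∧ muBar (frontier R) = 0

/-- `hitsR R x k` holds iff `k ≥ 1` and `F̄^[k] (x,1) ∈ R`. -/
def hitsR (R : Set (ℝ × ℝ)) (x : ℝ) (k : ℕ) : Prop := 1 ≤ k ∧ fareyNE^[k] (x, 1) ∈ R

/-- `Nidx R x n = N_n`: `N_0 = 0` and, for `n ≥ 1`, the `n`-th smallest `k ≥ 1`
with `F̄^[k] (x,1) ∈ R`. -/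
def Nidx (R : Set (ℝ × ℝ)) (x : ℝ) : ℕ → ℕ
  | 0 => 0
  | n + 1 => Nat.nth (hitsR R x) n

/-- `h(x,y) = (1−y)/(x + y − xy)`. -/
def hIto (p : ℝ × ℝ) : ℝ := (1 - p.2) / (p.1 + p.2 - p.1 * p.2)

/-- `Θ_n(x) = s_n(x)·|s_n(x)·x − u_n(x)|`, the approximation coefficient of the
`n`-th Farey convergent `u_n(x)/s_n(x)`. -/
def ThetaF (x : ℝ) (n : ℕ) : ℝ := (sF x n : ℝ) * |(sF x n : ℝ) * x - (uF x n : ℝ)|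

/-- `Θ_n^R(x) = s_n^R·|s_n^R·x − u_n^R|` where `u_n^R = u_{N_n}(x)`, `s_n^R = s_{N_n}(x)`. -/
def ThetaR (R : Set (ℝ × ℝ)) (x : ℝ) (n : ℕ) : ℝ := ThetaF x (Nidx R x n)

/-- The Gauss map. -/
def gaussMap (x : ℝ) : ℝ := Int.fract (1 / x)

/-- `pquot x n` is the RCF partial quotient `a_{n+1}(x)`. -/
def pquot (x : ℝ) (n : ℕ) : ℤ := ⌊1 / (gaussMap^[n] x)⌋

/-- `pnum x (j+1)` is the RCF numerator `p_j(x)`; `pnum x 0 = p_{-1} = 1`. -/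
def pnum (x : ℝ) : ℕ → ℤ
  | 0 => 1
  | 1 => 0
  | n + 2 => pquot x n * pnum x (n + 1) + pnum x n

/-- `qden x (j+1)` is the RCF denominator `q_j(x)`; `qden x 0 = q_{-1} = 0`. -/
def qden (x : ℝ) : ℕ → ℤ
  | 0 => 0
  | 1 => 1
  | n + 2 => pquot x n * qden x (n + 1) + qden x n

/-- The approximation coefficient `Θ(x, p/q) = q·|q·x − p|`. -/
def Theta (x : ℝ) (p q : ℤ) : ℝ := (q : ℝ) * |(q : ℝ) * x - (p : ℝ)|

/-- `medTheta x l j = Θ(x, (l·p_j + p_{j−1})/(l·q_j + q_{j−1}))`. -/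
def medTheta (x : ℝ) (l : ℤ) (j : ℕ) : ℝ :=
  Theta x (l * pnum x (j + 1) + pnum x j) (l * qden x (j + 1) + qden x j)

end

/-- The limiting distribution function, with normalising constant `C = log((a+2)/(a+1))`. -/
noncomputable def dist9 (a : ℕ) (z : ℝ) : ℝ :=
  (1 / Real.log (((a:ℝ) + 2) / ((a:ℝ) + 1))) *
    (if z ≤ ((a:ℝ) + 1) / ((a:ℝ) + 2) then
        ((a:ℝ) + 1) * z / (a:ℝ) - 1 + Real.log ((a:ℝ) / (((a:ℝ) + 1) * z))
      else if z ≤ (a:ℝ) then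
        z / ((a:ℝ) * ((a:ℝ) + 1)) + Real.log ((a:ℝ) * ((a:ℝ) + 2) / (((a:ℝ) + 1) ^ 2))
      else
        1 - z / ((a:ℝ) + 1) + Real.log (((a:ℝ) + 2) * z / (((a:ℝ) + 1) ^ 2)))

/-! ### The maximal ergodic inequality -/

theorem integral_nonneg_of_ae_exists_birkhoffSum_pos {α : Type*} [MeasurableSpace α]
    {μ : Measure α} {T : α → α} (hT : MeasurePreserving T μ μ) {g : α → ℝ} (hg : Integrable g μ)
    (hgm : Measurable g) (hpos : ∀ᵐ x ∂μ, ∃ n, 0 < birkhoffSum T g n x) : 0 ≤ ∫ x, g x ∂μ := by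
  let M : ℕ → α → ℝ := fun N => Nat.rec (fun _ => 0) (fun _ m x => max 0 (g x + m (T x))) N
  have M0 : ∀ x, M 0 x = 0 := fun _ => rfl
  have Ms : ∀ N x, M (N + 1) x = max 0 (g x + M N (T x)) := fun _ _ => rfl
  have Mmeas : ∀ N, Measurable (M N) := by
    intro N
    induction N with
    | zero => exact measurable_const
    | succ N ih => exact measurable_const.max (hgm.add (ih.comp hT.measurable))
  have Mint : ∀ N, Integrable (M N) μ := by
    intro N
    induction N with
    | zero => exact integrable_zero _ _ _
    | succ N ih =>
      exact (integrable_zero _ _ _).sup (hg.add (hT.integrable_comp_of_integrable ih))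
  have MTint : ∀ N, Integrable (fun x => M N (T x)) μ := fun N =>
    hT.integrable_comp_of_integrable (Mint N)
  have Mnn : ∀ N x, 0 ≤ M N x := by
    intro N x
    cases N with
    | zero => exact le_rfl
    | succ N => exact le_max_left _ _
  have Mmono : ∀ N x, M N x ≤ M (N + 1) x := by
    intro N
    induction N with
    | zero => intro x; exact Mnn 1 x
    | succ N ih =>
      intro x
      rw [Ms, Ms (N + 1)]
      exact max_le_max le_rfl (by linarith [ih (T x)])
  have Mmono' : ∀ x, Monotone fun N => M N x := fun x => monotone_nat_of_le_succ fun N => Mmono N x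
  have hS : ∀ n x, birkhoffSum T g n x ≤ M n x := by
    intro n
    induction n with
    | zero => intro x; simp [M0]
    | succ n ih =>
      intro x
      rw [birkhoffSum_succ', Ms]
      exact le_max_of_le_right (by linarith [ih (T x)])
  let A : ℕ → Set α := fun N => {x | 0 < M N x}
  have hA : ∀ N, MeasurableSet (A N) := fun N => measurableSet_lt measurable_const (Mmeas N)
  have key : ∀ N, 0 ≤ ∫ x, (A (N + 1)).indicator g x ∂μ := by
    intro N
    have h1 : ∫ x, (M (N + 1) x - M (N + 1) (T x)) ∂μ ≤ ∫ x, (A (N + 1)).indicator g x ∂μ := by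
      refine integral_mono (f := fun x => M (N + 1) x - M (N + 1) (T x))
        ((Mint (N + 1)).sub (MTint (N + 1))) (hg.indicator (hA (N + 1))) fun x => ?_
      by_cases hx : 0 < M (N + 1) x
      · have : x ∈ A (N + 1) := hx
        simp only [Set.indicator_of_mem this]
        have h2 := Mmono N (T x)
        rw [Ms] at hx
        have h3 : M (N + 1) x = g x + M N (T x) := by
          rw [Ms]
          rcases max_cases 0 (g x + M N (T x)) with h | h
          · rw [h.1] at hx; exact absurd hx (lt_irrefl _)
          · exact h.1
        change M (N + 1) x - M (N + 1) (T x) ≤ g x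
        linarith
      · have : x ∉ A (N + 1) := hx
        simp only [Set.indicator_of_notMem this]
        have h2 := Mnn (N + 1) (T x)
        change M (N + 1) x - M (N + 1) (T x) ≤ 0
        linarith
    rw [integral_sub (Mint (N + 1)) (MTint (N + 1))] at h1
    have h2 : ∫ x, M (N + 1) (T x) ∂μ = ∫ x, M (N + 1) x ∂μ := by
      conv_rhs => rw [← hT.map_eq]
      exact (integral_map hT.aemeasurable
        (by rw [hT.map_eq]; exact (Mint (N + 1)).aestronglyMeasurable)).symm
    linarith
  have hlim : Tendsto (fun N => ∫ x, (A (N + 1)).indicator g x ∂μ) atTop (𝓝 (∫ x, g x ∂μ)) := by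
    apply tendsto_integral_of_dominated_convergence (fun x => ‖g x‖)
    · exact fun N => (hg.indicator (hA (N + 1))).aestronglyMeasurable
    · exact hg.norm
    · exact fun N => Eventually.of_forall fun x => norm_indicator_le_norm_self _ _
    · filter_upwards [hpos] with x hx
      obtain ⟨n, hn⟩ := hx
      apply tendsto_const_nhds.congr'
      filter_upwards [eventually_ge_atTop n] with N hN
      have : x ∈ A (N + 1) := hn.trans_le ((hS n x).trans (Mmono' x (Nat.le_succ_of_le hN)))
      rw [Set.indicator_of_mem this]
  exact ge_of_tendsto' hlim key

/-! ### The Gauss map and its inverse branches -/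

/-- The irrational numbers of the unit interval. -/
def irrUnit : Set ℝ := {x | x ∈ Set.Ioo (0 : ℝ) 1 ∧ Irrational x}

theorem measurableSet_irrUnit : MeasurableSet irrUnit :=
  measurableSet_Ioo.inter (Set.countable_range ((↑) : ℚ → ℝ)).measurableSet.compl

theorem ae_mem_irrUnit_iff : ∀ᵐ x ∂(volume : Measure ℝ), x ∈ irrUnit ↔ x ∈ Set.Ioo (0 : ℝ) 1 := by
  have h : ∀ᵐ x ∂(volume : Measure ℝ), Irrational x := by
    rw [ae_iff]
    have : {x : ℝ | ¬ Irrational x} = Set.range ((↑) : ℚ → ℝ) := by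
      ext x; simp [Irrational]
    rw [this]
    exact (Set.countable_range _).measure_zero _
  filter_upwards [h] with x hx
  exact ⟨fun h => h.1, fun h => ⟨h, hx⟩⟩

theorem irrUnit_ae_eq : irrUnit =ᵐ[volume] Set.Ioo (0 : ℝ) 1 := by
  filter_upwards [ae_mem_irrUnit_iff] with x hx
  exact propext hx

theorem volume_irrUnit : volume irrUnit = 1 := by
  rw [measure_congr irrUnit_ae_eq]; simp

theorem one_le_floor_one_div {x : ℝ} (hx : x ∈ irrUnit) : 1 ≤ ⌊1 / x⌋ := by
  rw [Int.le_floor, Int.cast_one, le_div_iff₀ hx.1.1]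
  linarith [hx.1.2]

theorem floor_add_gaussMap (x : ℝ) : (⌊1 / x⌋ : ℝ) + gaussMap x = 1 / x :=
  Int.floor_add_fract _

theorem gaussMap_mem_irrUnit {x : ℝ} (hx : x ∈ irrUnit) : gaussMap x ∈ irrUnit := by
  have hirr : Irrational (gaussMap x) := by
    have : Irrational (1 / x) := by rw [one_div]; exact irrational_inv_iff.2 hx.2
    unfold gaussMap Int.fract
    exact this.sub_intCast _
  refine ⟨⟨lt_of_le_of_ne (Int.fract_nonneg _) fun h => ?_, Int.fract_lt_one _⟩, hirr⟩
  apply hirr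
  exact ⟨0, by rw [Rat.cast_zero]; exact h⟩

theorem gaussMap_iterate_mem_irrUnit {x : ℝ} (hx : x ∈ irrUnit) (n : ℕ) :
    gaussMap^[n] x ∈ irrUnit := by
  induction n with
  | zero => exact hx
  | succ n ih => rw [Function.iterate_succ_apply']; exact gaussMap_mem_irrUnit ih

theorem one_div_int_add_mem_irrUnit {k : ℤ} (hk : 1 ≤ k) {t : ℝ} (ht : t ∈ irrUnit) :
    1 / ((k : ℝ) + t) ∈ irrUnit := by
  have hk' : (1 : ℝ) ≤ k := by exact_mod_cast hk
  have h0 := ht.1.1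
  refine ⟨⟨by positivity, ?_⟩, ?_⟩
  · rw [div_lt_one (by linarith)]; linarith
  · rw [one_div, irrational_inv_iff]
    exact ht.2.intCast_add k

theorem floor_int_add {k : ℤ} {t : ℝ} (ht : t ∈ irrUnit) : ⌊(k : ℝ) + t⌋ = k := by
  rw [Int.floor_eq_iff]
  constructor <;> linarith [ht.1.1, ht.1.2]

theorem gaussMap_one_div_int_add {k : ℤ} {t : ℝ} (ht : t ∈ irrUnit) :
    gaussMap (1 / ((k : ℝ) + t)) = t := by
  unfold gaussMap
  rw [one_div_one_div, Int.fract, floor_int_add ht]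
  ring

theorem measurable_gaussMap : Measurable gaussMap :=
  measurable_fract.comp (measurable_const.div measurable_id)

theorem one_le_pquot {x : ℝ} (hx : x ∈ irrUnit) (n : ℕ) : 1 ≤ pquot x n :=
  one_le_floor_one_div (gaussMap_iterate_mem_irrUnit hx n)

theorem pquot_add (x : ℝ) (n : ℕ) :
    (pquot x n : ℝ) + gaussMap^[n + 1] x = 1 / gaussMap^[n] x := by
  rw [Function.iterate_succ_apply']
  exact floor_add_gaussMap _

theorem qden_nonneg {x : ℝ} (hx : x ∈ irrUnit) (n : ℕ) : 0 ≤ qden x n ∧ 1 ≤ qden x (n + 1) := by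
  induction n with
  | zero => simp [qden]
  | succ n ih =>
    refine ⟨by omega, ?_⟩
    rw [qden]
    nlinarith [one_le_pquot hx n, ih.1, ih.2]

theorem qden_le_succ {x : ℝ} (hx : x ∈ irrUnit) (n : ℕ) : qden x n ≤ qden x (n + 1) := by
  cases n with
  | zero => simp [qden]
  | succ n =>
    rw [qden]
    nlinarith [one_le_pquot hx n, (qden_nonneg hx n).1, (qden_nonneg hx n).2]

theorem le_qden_succ {x : ℝ} (hx : x ∈ irrUnit) (n : ℕ) : (n : ℤ) ≤ qden x (n + 1) := by
  induction n with
  | zero => simp [qden]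
  | succ n ih =>
    rw [qden]
    push_cast
    cases n with
    | zero => simpa [qden] using one_le_pquot hx 0
    | succ n =>
      nlinarith [one_le_pquot hx (n + 1), (qden_nonneg hx n).2, (qden_nonneg hx (n + 1)).2]

theorem pnum_qden_det (x : ℝ) (n : ℕ) :
    pnum x n * qden x (n + 1) - pnum x (n + 1) * qden x n = (-1) ^ n := by
  induction n with
  | zero => simp [pnum, qden]
  | succ n ih =>
    rw [pnum, qden, pow_succ, ← ih]
    ring

/-- The inverse branch of `gaussMap^[n]` on the cylinder containing `x`. -/
noncomputable def gaussBranch (x : ℝ) (n : ℕ) (t : ℝ) : ℝ :=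
  ((pnum x (n + 1) : ℝ) + t * pnum x n) / ((qden x (n + 1) : ℝ) + t * qden x n)

theorem gaussBranch_den_bounds {x : ℝ} (hx : x ∈ irrUnit) (n : ℕ) {t : ℝ} (h0 : 0 ≤ t)
    (h1 : t ≤ 1) : 0 < (qden x (n + 1) : ℝ) ∧
      (qden x (n + 1) : ℝ) ≤ (qden x (n + 1) : ℝ) + t * qden x n ∧
      (qden x (n + 1) : ℝ) + t * qden x n ≤ 2 * qden x (n + 1) := by
  have ha : (0 : ℝ) ≤ qden x n := by exact_mod_cast (qden_nonneg hx n).1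
  have hb : (1 : ℝ) ≤ qden x (n + 1) := by exact_mod_cast (qden_nonneg hx n).2
  have hc : (qden x n : ℝ) ≤ qden x (n + 1) := by exact_mod_cast qden_le_succ hx n
  exact ⟨by linarith, by nlinarith, by nlinarith⟩

theorem gaussBranch_zero (x t : ℝ) : gaussBranch x 0 t = t := by
  simp [gaussBranch, pnum, qden]

theorem gaussBranch_succ {x : ℝ} (hx : x ∈ irrUnit) (n : ℕ) {t : ℝ} (ht : 0 < t) :
    gaussBranch x (n + 1) t = gaussBranch x n (1 / (pquot x n + t)) := by
  have hk : (1 : ℝ) ≤ pquot x n := by exact_mod_cast one_le_pquot hx n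
  have ha : (0 : ℝ) ≤ qden x n := by exact_mod_cast (qden_nonneg hx n).1
  have hb : (1 : ℝ) ≤ qden x (n + 1) := by exact_mod_cast (qden_nonneg hx n).2
  have hs : (0 : ℝ) < pquot x n + t := by linarith
  simp only [gaussBranch, pnum, qden]
  push_cast
  have h1 : (0 : ℝ) < pquot x n * qden x (n + 1) + qden x n + t * qden x (n + 1) := by
    nlinarith
  have h2 : (0 : ℝ) < qden x (n + 1) + 1 / (pquot x n + t) * qden x n := by positivity
  rw [div_eq_div_iff h1.ne' h2.ne']
  field_simp
  ring

theorem gaussBranch_mem {x : ℝ} (hx : x ∈ irrUnit) (n : ℕ) {t : ℝ} (ht : t ∈ irrUnit) :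
    gaussBranch x n t ∈ irrUnit ∧ gaussMap^[n] (gaussBranch x n t) = t := by
  induction n generalizing t with
  | zero => rw [gaussBranch_zero]; exact ⟨ht, rfl⟩
  | succ n ih =>
    rw [gaussBranch_succ hx n ht.1.1, Function.iterate_succ_apply']
    obtain ⟨h1, h2⟩ := ih (one_div_int_add_mem_irrUnit (one_le_pquot hx n) ht)
    exact ⟨h1, by rw [h2, gaussMap_one_div_int_add ht]⟩

theorem gaussBranch_gaussMap_iterate {x : ℝ} (hx : x ∈ irrUnit) (n : ℕ) :
    gaussBranch x n (gaussMap^[n] x) = x := by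
  induction n with
  | zero => exact gaussBranch_zero _ _
  | succ n ih =>
    rw [gaussBranch_succ hx n (gaussMap_iterate_mem_irrUnit hx _).1.1, pquot_add,
      one_div_one_div, ih]

theorem abs_gaussBranch_sub {x : ℝ} (hx : x ∈ irrUnit) (n : ℕ) {s t : ℝ}
    (hs : s ∈ Set.Icc (0 : ℝ) 1) (ht : t ∈ Set.Icc (0 : ℝ) 1) :
    |gaussBranch x n s - gaussBranch x n t| =
      |s - t| / (((qden x (n + 1) : ℝ) + s * qden x n) * (qden x (n + 1) + t * qden x n)) := by
  obtain ⟨h0, h1, -⟩ := gaussBranch_den_bounds hx n hs.1 hs.2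
  obtain ⟨-, h2, -⟩ := gaussBranch_den_bounds hx n ht.1 ht.2
  have hs' : (0 : ℝ) < qden x (n + 1) + s * qden x n := by linarith
  have ht' : (0 : ℝ) < qden x (n + 1) + t * qden x n := by linarith
  have hdet : (pnum x n : ℝ) * qden x (n + 1) - pnum x (n + 1) * qden x n = (-1) ^ n := by
    exact_mod_cast pnum_qden_det x n
  have : gaussBranch x n s - gaussBranch x n t = (-1) ^ n * (s - t) /
      (((qden x (n + 1) : ℝ) + s * qden x n) * (qden x (n + 1) + t * qden x n)) := by
    rw [← hdet, gaussBranch, gaussBranch, div_sub_div _ _ hs'.ne' ht'.ne']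
    congr 1
    ring
  rw [this, abs_div, abs_mul, abs_pow, abs_neg, abs_one, one_pow, one_mul,
    abs_of_pos (mul_pos hs' ht')]

theorem irrUnit_subset_Icc : irrUnit ⊆ Set.Icc (0 : ℝ) 1 := fun _ h => ⟨h.1.1.le, h.1.2.le⟩

/-! ### Ergodicity of the Gauss map with respect to Lebesgue measure -/

theorem volume_le_mul_volume_gaussBranch_image {x : ℝ} (hx : x ∈ irrUnit) (n : ℕ) {E : Set ℝ}
    (hE : E ⊆ irrUnit) :
    volume E ≤ ENNReal.ofReal (4 * (qden x (n + 1) : ℝ) ^ 2) * volume (gaussBranch x n '' E) := by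
  have hinv : gaussMap^[n] '' (gaussBranch x n '' E) = E := by
    rw [Set.image_image]
    refine (Set.image_congr fun t ht => ?_).trans (Set.image_id' E)
    exact (gaussBranch_mem hx n (hE ht)).2
  have hlip : LipschitzOnWith (Real.toNNReal (4 * (qden x (n + 1) : ℝ) ^ 2)) gaussMap^[n]
      (gaussBranch x n '' E) := by
    apply LipschitzOnWith.of_dist_le_mul
    rintro _ ⟨s, hs, rfl⟩ _ ⟨t, ht, rfl⟩
    have hs' := irrUnit_subset_Icc (hE hs)
    have ht' := irrUnit_subset_Icc (hE ht)
    obtain ⟨h0, h1, h2⟩ := gaussBranch_den_bounds hx n hs'.1 hs'.2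
    obtain ⟨-, h3, h4⟩ := gaussBranch_den_bounds hx n ht'.1 ht'.2
    rw [(gaussBranch_mem hx n (hE hs)).2, (gaussBranch_mem hx n (hE ht)).2, Real.dist_eq,
      Real.dist_eq, abs_gaussBranch_sub hx n hs' ht', Real.coe_toNNReal _ (by positivity),
      mul_div_assoc', le_div_iff₀ (by nlinarith), mul_comm]
    apply mul_le_mul_of_nonneg_right _ (abs_nonneg _)
    nlinarith
  have := hlip.hausdorffMeasure_image_le (zero_le_one' ℝ)
  rw [hinv, hausdorffMeasure_real, ENNReal.rpow_one] at this
  exact this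

theorem gaussBranch_image_subset_closedBall {x : ℝ} (hx : x ∈ irrUnit) (n : ℕ) {E : Set ℝ}
    (hE : E ⊆ irrUnit) :
    gaussBranch x n '' E ⊆ Metric.closedBall x (1 / (qden x (n + 1) : ℝ) ^ 2) := by
  rintro _ ⟨t, ht, rfl⟩
  have hs := irrUnit_subset_Icc (gaussMap_iterate_mem_irrUnit hx n)
  have ht := irrUnit_subset_Icc (hE ht)
  obtain ⟨h0, h1, -⟩ := gaussBranch_den_bounds hx n hs.1 hs.2
  obtain ⟨-, h3, -⟩ := gaussBranch_den_bounds hx n ht.1 ht.2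
  rw [Metric.mem_closedBall, Real.dist_eq]
  nth_rewrite 2 [← gaussBranch_gaussMap_iterate hx n]
  rw [abs_gaussBranch_sub hx n ht hs]
  apply div_le_div₀ zero_le_one _ (by positivity) (by nlinarith)
  rw [abs_le]
  constructor <;> linarith [hs.1, hs.2, ht.1, ht.2]

theorem tendsto_one_div_qden_sq {x : ℝ} (hx : x ∈ irrUnit) :
    Tendsto (fun n => 1 / (qden x (n + 1) : ℝ) ^ 2) atTop (𝓝[>] 0) := by
  rw [tendsto_nhdsWithin_iff]
  constructor
  · have h : Tendsto (fun n => (qden x (n + 1) : ℝ)) atTop atTop := by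
      apply tendsto_atTop_mono _ tendsto_natCast_atTop_atTop
      intro n
      exact_mod_cast le_qden_succ hx n
    exact ((tendsto_pow_atTop two_ne_zero).comp h).inv_tendsto_atTop.congr fun n => by simp
  · refine Eventually.of_forall fun n => ?_
    have : (1 : ℝ) ≤ qden x (n + 1) := by exact_mod_cast (qden_nonneg hx n).2
    exact Set.mem_Ioi.2 (by positivity)

theorem volume_eq_zero_or_of_gaussMap_preimage_subset {E : Set ℝ} (hEm : MeasurableSet E)
    (hE : E ⊆ irrUnit) (hinv : ∀ x ∈ irrUnit, gaussMap x ∈ E → x ∈ E) :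
    volume E = 0 ∨ volume (irrUnit \ E) = 0 := by
  by_contra! hcon
  obtain ⟨hE0, hF0⟩ := hcon
  have hinvn : ∀ n, ∀ x ∈ irrUnit, gaussMap^[n] x ∈ E → x ∈ E := by
    intro n
    induction n with
    | zero => exact fun x _ h => h
    | succ n ih =>
      intro x hx h
      rw [Function.iterate_succ_apply] at h
      exact hinv x hx (ih _ (gaussMap_mem_irrUnit hx) h)
  have hEfin : volume E ≠ ⊤ := by
    refine ne_top_of_le_ne_top ?_ (measure_mono hE)
    rw [volume_irrUnit]; exact ENNReal.one_ne_top
  set F := irrUnit \ E with hF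
  have hFm : MeasurableSet F := measurableSet_irrUnit.diff hEm
  have hdens := IsUnifLocDoublingMeasure.ae_tendsto_measure_inter_div (volume : Measure ℝ) F 1
  rw [ae_restrict_iff' hFm] at hdens
  obtain ⟨x, hxF, hlim⟩ : ∃ x ∈ F, Tendsto (fun n : ℕ =>
      volume (F ∩ Metric.closedBall x (1 / (qden x (n + 1) : ℝ) ^ 2)) /
        volume (Metric.closedBall x (1 / (qden x (n + 1) : ℝ) ^ 2))) atTop (𝓝 1) := by
    by_contra! hno
    apply hF0
    rw [measure_eq_zero_iff_ae_notMem]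
    filter_upwards [hdens] with y hy hyF
    refine hno y hyF (hy hyF (fun _ => y) _ (tendsto_one_div_qden_sq hyF.1)
      (Eventually.of_forall fun n => Metric.mem_closedBall_self (by positivity)))
  have hxI : x ∈ irrUnit := hxF.1
  set e := (volume E).toReal with he
  have hepos : 0 < e := ENNReal.toReal_pos hE0 hEfin
  have hbound : ∀ n, (volume (F ∩ Metric.closedBall x (1 / (qden x (n + 1) : ℝ) ^ 2)) /
      volume (Metric.closedBall x (1 / (qden x (n + 1) : ℝ) ^ 2))) ≤
      ENNReal.ofReal (1 - e / 8) := by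
    intro n
    have hq : (1 : ℝ) ≤ qden x (n + 1) := by exact_mod_cast (qden_nonneg hxI n).2
    set q : ℝ := (qden x (n + 1) : ℝ) with hqdef
    set B := Metric.closedBall x (1 / q ^ 2) with hB
    have hBv : volume B = ENNReal.ofReal (2 * (1 / q ^ 2)) := Real.volume_closedBall _ _
    have h1 : gaussBranch x n '' E ⊆ E ∩ B := by
      refine Set.subset_inter ?_ (gaussBranch_image_subset_closedBall hxI n hE)
      rintro _ ⟨t, ht, rfl⟩
      obtain ⟨h2, h3⟩ := gaussBranch_mem hxI n (hE ht)
      exact hinvn n _ h2 (by rwa [h3])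
    have h2 : volume E ≤ ENNReal.ofReal (4 * q ^ 2) * volume (E ∩ B) :=
      (volume_le_mul_volume_gaussBranch_image hxI n hE).trans
        (mul_le_mul_right (measure_mono h1) _)
    have h3 : volume (F ∩ B) + volume (E ∩ B) ≤ volume B := by
      rw [← measure_union _ (hEm.inter Metric.isClosed_closedBall.measurableSet)]
      · exact measure_mono (Set.union_subset Set.inter_subset_right Set.inter_subset_right)
      · exact (Set.disjoint_sdiff_left (s := E) (t := irrUnit)).mono Set.inter_subset_left
          Set.inter_subset_left
    have hBfin : volume B ≠ ⊤ := by rw [hBv]; exact ENNReal.ofReal_ne_top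
    have hFfin : volume (F ∩ B) ≠ ⊤ := ne_top_of_le_ne_top hBfin (measure_mono Set.inter_subset_right)
    have hEBfin : volume (E ∩ B) ≠ ⊤ :=
      ne_top_of_le_ne_top hBfin (measure_mono Set.inter_subset_right)
    have h2' : e ≤ 4 * q ^ 2 * (volume (E ∩ B)).toReal := by
      have := ENNReal.toReal_mono (ENNReal.mul_ne_top ENNReal.ofReal_ne_top hEBfin) h2
      rwa [ENNReal.toReal_mul, ENNReal.toReal_ofReal (by positivity)] at this
    have h3' : (volume (F ∩ B)).toReal + (volume (E ∩ B)).toReal ≤ 2 * (1 / q ^ 2) := by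
      have := ENNReal.toReal_mono hBfin h3
      rwa [ENNReal.toReal_add hFfin hEBfin, hBv, ENNReal.toReal_ofReal (by positivity)] at this
    have h4 : e / (4 * q ^ 2) ≤ (volume (E ∩ B)).toReal := by
      rw [div_le_iff₀ (by positivity)]; linarith
    have h5 : (volume (F ∩ B)).toReal ≤ (1 - e / 8) * (2 * (1 / q ^ 2)) := by
      have : e / (4 * q ^ 2) = e / 8 * (2 * (1 / q ^ 2)) := by field_simp; norm_num
      linarith
    rw [ENNReal.div_le_iff (by rw [hBv]; simp; positivity) hBfin, hBv,
      ← ENNReal.ofReal_mul' (by positivity), ← ENNReal.ofReal_toReal hFfin]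
    exact ENNReal.ofReal_le_ofReal h5
  have h1 := le_of_tendsto' hlim hbound
  rw [ENNReal.one_le_ofReal] at h1
  linarith

/-! ### The natural extension of the Gauss map -/

/-- The natural extension of the Gauss map. -/
noncomputable def gaussNE (p : ℝ × ℝ) : ℝ × ℝ := (gaussMap p.1, 1 / ((⌊1 / p.1⌋ : ℝ) + p.2))

/-- The invariant measure of `gaussNE`, with density `(1 + t v)⁻²` on the irrational points of
the unit square. -/
noncomputable def gaussNEMeasure : Measure (ℝ × ℝ) :=
  (volume.restrict (irrUnit ×ˢ irrUnit)).withDensity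
    fun p => ENNReal.ofReal (1 / (1 + p.1 * p.2) ^ 2)

theorem measurable_gaussNE : Measurable gaussNE := by
  refine (measurable_gaussMap.comp measurable_fst).prodMk (measurable_const.div ?_)
  refine Measurable.add ?_ measurable_snd
  exact (measurable_from_top (f := fun n : ℤ => (n : ℝ))).comp
    (Int.measurable_floor.comp (measurable_const.div measurable_fst))

theorem measurable_gaussNE_density :
    Measurable fun p : ℝ × ℝ => ENNReal.ofReal (1 / (1 + p.1 * p.2) ^ 2) := by
  fun_prop

theorem gaussNE_image : gaussNE '' (irrUnit ×ˢ irrUnit) = irrUnit ×ˢ irrUnit := by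
  ext ⟨s, w⟩
  constructor
  · rintro ⟨⟨t, v⟩, ⟨ht, hv⟩, h⟩
    rw [← h]
    exact ⟨gaussMap_mem_irrUnit ht, one_div_int_add_mem_irrUnit (one_le_floor_one_div ht) hv⟩
  · rintro ⟨hs, hw⟩
    have hk := one_le_floor_one_div hw
    refine ⟨(1 / ((⌊1 / w⌋ : ℝ) + s), gaussMap w),
      ⟨one_div_int_add_mem_irrUnit hk hs, gaussMap_mem_irrUnit hw⟩, ?_⟩
    simp only [gaussNE]
    rw [gaussMap_one_div_int_add hs, one_div_one_div, floor_int_add hs, floor_add_gaussMap,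
      one_div_one_div]

theorem gaussNE_injOn : Set.InjOn gaussNE (irrUnit ×ˢ irrUnit) := by
  have key : ∀ p ∈ irrUnit ×ˢ irrUnit,
      p = (1 / ((⌊1 / (gaussNE p).2⌋ : ℝ) + (gaussNE p).1), gaussMap (gaussNE p).2) := by
    rintro ⟨t, v⟩ ⟨ht, hv⟩
    simp only [gaussNE]
    rw [one_div_one_div, floor_int_add hv, gaussMap_one_div_int_add hv, floor_add_gaussMap,
      one_div_one_div]
  intro p hp p' hp' h
  rw [key p hp, key p' hp', h]

/-- The derivative of `gaussNE`. -/
noncomputable def gaussNEDeriv (p : ℝ × ℝ) : ℝ × ℝ →L[ℝ] ℝ × ℝ :=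
  ((-(p.1 ^ 2)⁻¹) • ContinuousLinearMap.id ℝ ℝ).prodMap
    ((-(((⌊1 / p.1⌋ : ℝ) + p.2) ^ 2)⁻¹) • ContinuousLinearMap.id ℝ ℝ)

theorem det_gaussNEDeriv (p : ℝ × ℝ) :
    (gaussNEDeriv p).det = (p.1 ^ 2)⁻¹ * (((⌊1 / p.1⌋ : ℝ) + p.2) ^ 2)⁻¹ := by
  have : ((gaussNEDeriv p : ℝ × ℝ →L[ℝ] ℝ × ℝ) : ℝ × ℝ →ₗ[ℝ] ℝ × ℝ) =
      ((-(p.1 ^ 2)⁻¹) • (LinearMap.id : ℝ →ₗ[ℝ] ℝ)).prodMap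
        ((-(((⌊1 / p.1⌋ : ℝ) + p.2) ^ 2)⁻¹) • (LinearMap.id : ℝ →ₗ[ℝ] ℝ)) := rfl
  rw [ContinuousLinearMap.det, this, LinearMap.det_prodMap]
  simp

theorem hasFDerivAt_gaussNE {p : ℝ × ℝ} (hp : p ∈ irrUnit ×ˢ irrUnit) :
    HasFDerivAt gaussNE (gaussNEDeriv p) p := by
  obtain ⟨t, v⟩ := p
  obtain ⟨ht, hv⟩ := hp
  change t ∈ irrUnit at ht
  change v ∈ irrUnit at hv
  set k := ⌊1 / t⌋ with hk
  have hk1 : (1 : ℝ) ≤ k := by exact_mod_cast one_le_floor_one_div ht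
  have hev : ∀ᶠ q : ℝ × ℝ in 𝓝 (t, v), gaussNE q = (q.1⁻¹ - k, ((k : ℝ) + q.2)⁻¹) := by
    have hcont : ContinuousAt (fun q : ℝ × ℝ => 1 / q.1) (t, v) :=
      continuousAt_const.div continuousAt_fst ht.1.1.ne'
    have hm := gaussMap_mem_irrUnit ht
    have hfl := floor_add_gaussMap t
    have h1 : ∀ᶠ q : ℝ × ℝ in 𝓝 (t, v), (k : ℝ) < 1 / q.1 :=
      hcont.eventually_const_lt (by change (k : ℝ) < 1 / t; linarith [hm.1.1])
    have h2 : ∀ᶠ q : ℝ × ℝ in 𝓝 (t, v), 1 / q.1 < (k : ℝ) + 1 :=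
      hcont.eventually_lt_const (by change 1 / t < (k : ℝ) + 1; linarith [hm.1.2])
    filter_upwards [h1, h2] with q h1 h2
    have : ⌊1 / q.1⌋ = k := Int.floor_eq_iff.2 ⟨h1.le, h2⟩
    simp only [gaussNE, gaussMap, Int.fract, this]
    simp only [one_div]
  refine HasFDerivAt.congr_of_eventuallyEq ?_ hev
  have hd1 : HasDerivAt (fun s : ℝ => s⁻¹ - k) (-(t ^ 2)⁻¹) t :=
    (hasDerivAt_inv ht.1.1.ne').sub_const _
  have hd2 : HasDerivAt (fun s : ℝ => ((k : ℝ) + s)⁻¹) (-(((k : ℝ) + v) ^ 2)⁻¹) v := by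
    have h := ((hasDerivAt_id v).const_add (k : ℝ)).inv (by
      simp only [id]; linarith [hv.1.1])
    simpa [neg_div, Pi.inv_def] using h
  have h := HasFDerivAt.prodMap (t, v) hd1.hasFDerivAt hd2.hasFDerivAt
  refine h.congr_fderiv ?_
  apply ContinuousLinearMap.ext
  intro q
  apply Prod.ext <;> simp [gaussNEDeriv, hk, mul_comm]

theorem measurePreserving_gaussNE :
    MeasurePreserving gaussNE gaussNEMeasure gaussNEMeasure := by
  refine ⟨measurable_gaussNE, ?_⟩
  have hD : MeasurableSet (irrUnit ×ˢ irrUnit) := measurableSet_irrUnit.prod measurableSet_irrUnit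
  ext A hA
  have hA' := measurable_gaussNE hA
  rw [Measure.map_apply measurable_gaussNE hA, gaussNEMeasure, withDensity_apply _ hA,
    withDensity_apply _ hA', ← lintegral_indicator hA, ← lintegral_indicator hA']
  conv_rhs => rw [← gaussNE_image]
  rw [lintegral_image_eq_lintegral_abs_det_fderiv_mul volume hD
    (fun p hp => (hasFDerivAt_gaussNE hp).hasFDerivWithinAt) gaussNE_injOn]
  refine setLIntegral_congr_fun hD fun p hp => ?_
  obtain ⟨t, v⟩ := p
  obtain ⟨ht, hv⟩ := hp
  change t ∈ irrUnit at ht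
  change v ∈ irrUnit at hv
  by_cases hpA : gaussNE (t, v) ∈ A
  · have hpA' : (t, v) ∈ gaussNE ⁻¹' A := hpA
    simp only [Set.indicator_of_mem hpA, Set.indicator_of_mem hpA']
    rw [← ENNReal.ofReal_mul (abs_nonneg _), det_gaussNEDeriv]
    congr 1
    simp only [gaussNE]
    have hfl := floor_add_gaussMap t
    have hk : (1 : ℝ) ≤ ⌊1 / t⌋ := by exact_mod_cast one_le_floor_one_div ht
    have ht0 := ht.1.1
    have hv0 := hv.1.1
    have hg0 := (gaussMap_mem_irrUnit ht).1.1
    have hkv : (0 : ℝ) < (⌊1 / t⌋ : ℝ) + v := by linarith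
    rw [abs_of_pos (by positivity)]
    have hs : gaussMap t = 1 / t - ⌊1 / t⌋ := by linarith
    have h1 : (1 : ℝ) + t * v =
        t * (((⌊1 / t⌋ : ℝ) + v) * (1 + gaussMap t * (1 / ((⌊1 / t⌋ : ℝ) + v)))) := by
      rw [mul_add, mul_one, ← mul_assoc, mul_comm _ (gaussMap t), mul_assoc, mul_one_div_cancel hkv.ne', hs]
      field_simp
      ring
    rw [h1]
    have h2 : (0 : ℝ) < 1 + gaussMap t * (1 / ((⌊1 / t⌋ : ℝ) + v)) := by positivity
    rw [mul_pow, mul_pow, one_div, mul_inv, mul_inv]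
    ring
  · have hpA' : (t, v) ∉ gaussNE ⁻¹' A := hpA
    simp only [Set.indicator_of_notMem hpA, Set.indicator_of_notMem hpA', mul_zero]

/-! ### Upper bounds for orbit averages of the natural extension -/

instance : IsFiniteMeasure gaussNEMeasure := by
  refine isFiniteMeasure_withDensity (ne_top_of_le_ne_top (b := volume (irrUnit ×ˢ irrUnit)) ?_ ?_)
  · rw [Measure.volume_eq_prod, Measure.prod_prod, volume_irrUnit, one_mul]
    exact ENNReal.one_ne_top
  · rw [← setLIntegral_one]
    refine setLIntegral_mono measurable_const fun p hp => ?_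
    rw [ENNReal.ofReal_le_one]
    have : 0 ≤ p.1 * p.2 := mul_nonneg hp.1.1.1.le hp.2.1.1.le
    rw [div_le_one (by positivity)]
    nlinarith

theorem ae_gaussNEMeasure_mem : ∀ᵐ p ∂gaussNEMeasure, p ∈ irrUnit ×ˢ irrUnit :=
  (withDensity_absolutelyContinuous _ _).ae_le
    (ae_restrict_mem (measurableSet_irrUnit.prod measurableSet_irrUnit))

theorem ae_gaussNEMeasure_of_ae_volume {P : ℝ × ℝ → Prop} (h : ∀ᵐ p ∂volume, P p) :
    ∀ᵐ p ∂gaussNEMeasure, P p :=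
  (withDensity_absolutelyContinuous _ _).ae_le (ae_restrict_of_ae h)

theorem gaussNEMeasure_univ_ne_zero : gaussNEMeasure Set.univ ≠ 0 := by
  intro h
  rw [gaussNEMeasure, withDensity_apply _ MeasurableSet.univ, Measure.restrict_univ,
    lintegral_eq_zero_iff measurable_gaussNE_density] at h
  have hD : MeasurableSet (irrUnit ×ˢ irrUnit) := measurableSet_irrUnit.prod measurableSet_irrUnit
  rw [Filter.EventuallyEq, ae_restrict_iff' hD] at h
  have h0 : volume (irrUnit ×ˢ irrUnit) = 0 := by
    rw [measure_eq_zero_iff_ae_notMem]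
    filter_upwards [h] with p hp hpD
    have h1 := hp hpD
    have : 0 < p.1 * p.2 := mul_pos hpD.1.1.1 hpD.2.1.1
    simp only [Pi.zero_apply, ENNReal.ofReal_eq_zero] at h1
    have : 0 < 1 / (1 + p.1 * p.2) ^ 2 := by positivity
    linarith
  rw [Measure.volume_eq_prod, Measure.prod_prod, volume_irrUnit, one_mul] at h0
  exact one_ne_zero h0

theorem gaussNE_iterate_fst (p : ℝ × ℝ) (n : ℕ) : (gaussNE^[n] p).1 = gaussMap^[n] p.1 := by
  induction n with
  | zero => rfl
  | succ n ih => rw [Function.iterate_succ_apply', Function.iterate_succ_apply', ← ih]; rfl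

theorem gaussNE_mem {p : ℝ × ℝ} (hp : p ∈ irrUnit ×ˢ Set.Icc (0 : ℝ) 1) :
    gaussNE p ∈ irrUnit ×ˢ Set.Icc (0 : ℝ) 1 := by
  have hk : (1 : ℝ) ≤ ⌊1 / p.1⌋ := by exact_mod_cast one_le_floor_one_div hp.1
  have hv := hp.2.1
  refine ⟨gaussMap_mem_irrUnit hp.1, ?_, ?_⟩
  · simp only [gaussNE]; positivity
  · simp only [gaussNE]; rw [div_le_one (by linarith)]; linarith

theorem gaussNE_iterate_mem {p : ℝ × ℝ} (hp : p ∈ irrUnit ×ˢ Set.Icc (0 : ℝ) 1) (n : ℕ) :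
    gaussNE^[n] p ∈ irrUnit ×ˢ Set.Icc (0 : ℝ) 1 := by
  induction n with
  | zero => exact hp
  | succ n ih => rw [Function.iterate_succ_apply']; exact gaussNE_mem ih

theorem abs_gaussNE_snd_sub {p p' : ℝ × ℝ} (hp : p ∈ irrUnit ×ˢ Set.Icc (0 : ℝ) 1)
    (hp' : p' ∈ irrUnit ×ˢ Set.Icc (0 : ℝ) 1) (h : p.1 = p'.1) :
    |(gaussNE p).2 - (gaussNE p').2| = (gaussNE p).2 * (gaussNE p').2 * |p.2 - p'.2| := by
  have hk : (1 : ℝ) ≤ ⌊1 / p'.1⌋ := by exact_mod_cast one_le_floor_one_div hp'.1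
  have h1 : 0 < (⌊1 / p'.1⌋ : ℝ) + p.2 := by linarith [hp.2.1]
  have h2 : 0 < (⌊1 / p'.1⌋ : ℝ) + p'.2 := by linarith [hp'.2.1]
  simp only [gaussNE, h]
  rw [div_sub_div _ _ h1.ne' h2.ne', abs_div, abs_of_pos (mul_pos h1 h2)]
  have : 1 * ((⌊1 / p'.1⌋ : ℝ) + p'.2) - ((⌊1 / p'.1⌋ : ℝ) + p.2) * 1 = -(p.2 - p'.2) := by ring
  rw [this, abs_neg]
  field_simp

theorem gaussNE_snd_mul_le {p : ℝ × ℝ} (hp : p ∈ irrUnit ×ˢ Set.Icc (0 : ℝ) 1) :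
    p.2 * (gaussNE p).2 ≤ 1 / 2 := by
  have hk : (1 : ℝ) ≤ ⌊1 / p.1⌋ := by exact_mod_cast one_le_floor_one_div hp.1
  have h0 := hp.2.1
  have h1 := hp.2.2
  simp only [gaussNE]
  rw [mul_one_div, div_le_div_iff₀ (by linarith) two_pos]
  linarith

theorem dist_gaussNE_iterate_le {p p' : ℝ × ℝ} (hp : p ∈ irrUnit ×ˢ Set.Icc (0 : ℝ) 1)
    (hp' : p' ∈ irrUnit ×ˢ Set.Icc (0 : ℝ) 1) (h : p.1 = p'.1) (n : ℕ) :
    dist (gaussNE^[n] p) (gaussNE^[n] p') ≤ 2 * (1 / 2) ^ n := by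
  have hfst : ∀ n, (gaussNE^[n] p).1 = (gaussNE^[n] p').1 := fun n => by
    rw [gaussNE_iterate_fst, gaussNE_iterate_fst, h]
  have hm := gaussNE_iterate_mem hp
  have hm' := gaussNE_iterate_mem hp'
  have hone : ∀ n, |(gaussNE^[n] p).2 - (gaussNE^[n] p').2| ≤ 1 := fun n => by
    rw [abs_le]
    constructor <;> linarith [(hm n).2.1, (hm n).2.2, (hm' n).2.1, (hm' n).2.2]
  have key : |(gaussNE^[n] p).2 - (gaussNE^[n] p').2| ≤ 2 * (1 / 2) ^ n := by
    induction n using Nat.twoStepInduction with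
    | zero => linarith [hone 0]
    | one => linarith [hone 1]
    | more n ih _ =>
      have e1 := abs_gaussNE_snd_sub (hm n) (hm' n) (hfst n)
      have e2 := abs_gaussNE_snd_sub (hm (n + 1)) (hm' (n + 1)) (hfst (n + 1))
      have b1 := gaussNE_snd_mul_le (hm (n + 1))
      have b2 := gaussNE_snd_mul_le (hm' (n + 1))
      simp only [← Function.iterate_succ_apply'] at e1 e2 b1 b2
      rw [Nat.succ_eq_add_one] at e1 e2 b1 b2
      rw [e2, e1, pow_add]
      have n1 := (hm (n + 1)).2.1
      have n2 := (hm' (n + 1)).2.1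
      have n3 := (hm (n + 2)).2.1
      have n4 := (hm' (n + 2)).2.1
      have b3 := mul_le_mul b1 b2 (mul_nonneg n2 n4) (by norm_num)
      have b4 := mul_le_mul b3 ih (abs_nonneg _) (by norm_num)
      calc _ = _ := by ring
        _ ≤ _ := b4
        _ = _ := by ring
  rw [Prod.dist_eq, hfst n, dist_self, Real.dist_eq]
  exact max_le (by positivity) key

theorem limsup_coe_le_of_tendsto_sub {u w : ℕ → ℝ}
    (h : Tendsto (fun n => u n - w n) atTop (𝓝 0)) :
    limsup (fun n => (u n : EReal)) atTop ≤ limsup (fun n => (w n : EReal)) atTop := by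
  have hlim : limsup (fun n => ((u n - w n : ℝ) : EReal)) atTop = 0 :=
    ((continuous_coe_real_ereal.tendsto 0).comp h).limsup_eq
  have hle := EReal.limsup_add_le (f := atTop) (u := fun n => ((u n - w n : ℝ) : EReal))
    (v := fun n => (w n : EReal)) (Or.inl (by rw [hlim]; exact EReal.zero_ne_bot))
    (Or.inl (by rw [hlim]; exact EReal.zero_ne_top))
  rw [hlim, zero_add] at hle
  refine le_trans (le_of_eq ?_) hle
  congr 1
  ext n
  rw [Pi.add_apply, ← EReal.coe_add, sub_add_cancel]

theorem limsup_coe_eq_of_tendsto_sub {u w : ℕ → ℝ}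
    (h : Tendsto (fun n => u n - w n) atTop (𝓝 0)) :
    limsup (fun n => (u n : EReal)) atTop = limsup (fun n => (w n : EReal)) atTop :=
  le_antisymm (limsup_coe_le_of_tendsto_sub h)
    (limsup_coe_le_of_tendsto_sub (by simpa using h.neg))

theorem limsup_birkhoffAverage_gaussNE_eq {f : ℝ × ℝ → ℝ} {K : NNReal} (hf : LipschitzWith K f)
    {p p' : ℝ × ℝ} (hp : p ∈ irrUnit ×ˢ Set.Icc (0 : ℝ) 1)
    (hp' : p' ∈ irrUnit ×ˢ Set.Icc (0 : ℝ) 1) (h : p.1 = p'.1) :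
    limsup (fun n => ((birkhoffAverage ℝ gaussNE f n p : ℝ) : EReal)) atTop =
      limsup (fun n => ((birkhoffAverage ℝ gaussNE f n p' : ℝ) : EReal)) atTop := by
  apply limsup_coe_eq_of_tendsto_sub
  have hz : Tendsto (fun n => f (gaussNE^[n] p) - f (gaussNE^[n] p')) atTop (𝓝 0) := by
    have hb : Tendsto (fun n : ℕ => (K : ℝ) * (2 * (1 / 2 : ℝ) ^ n)) atTop (𝓝 0) := by
      simpa using ((tendsto_pow_atTop_nhds_zero_of_lt_one (by norm_num)
        (by norm_num : (1 / 2 : ℝ) < 1)).const_mul 2).const_mul (K : ℝ)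
    refine squeeze_zero_norm (fun n => ?_) hb
    rw [← dist_eq_norm]
    exact (hf.dist_le_mul _ _).trans
      (mul_le_mul_of_nonneg_left (dist_gaussNE_iterate_le hp hp' h n) K.2)
  refine hz.cesaro.congr fun n => ?_
  simp only [birkhoffAverage, birkhoffSum, smul_eq_mul, Finset.sum_sub_distrib]
  ring

theorem limsup_birkhoffAverage_gaussNE_apply {f : ℝ × ℝ → ℝ}
    (hb : Bornology.IsBounded (Set.range f)) (p : ℝ × ℝ) :
    limsup (fun n => ((birkhoffAverage ℝ gaussNE f n (gaussNE p) : ℝ) : EReal)) atTop =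
      limsup (fun n => ((birkhoffAverage ℝ gaussNE f n p : ℝ) : EReal)) atTop :=
  limsup_coe_eq_of_tendsto_sub (tendsto_birkhoffAverage_apply_sub_birkhoffAverage' ℝ hb _ _)

theorem mem_irrUnit_prod_Icc {x : ℝ} (hx : x ∈ irrUnit) {v : ℝ} (hv : v ∈ Set.Icc (0 : ℝ) 1) :
    (x, v) ∈ irrUnit ×ˢ Set.Icc (0 : ℝ) 1 := ⟨hx, hv⟩

theorem ae_limsup_birkhoffAverage_gaussNE_le {f : ℝ × ℝ → ℝ} {K : NNReal} (hf : LipschitzWith K f)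
    (hb : Bornology.IsBounded (Set.range f)) {c : ℝ}
    (hc : ∫ p, f p ∂gaussNEMeasure < c * gaussNEMeasure.real Set.univ) :
    ∀ᵐ x ∂(volume : Measure ℝ), x ∈ irrUnit →
      limsup (fun n => ((birkhoffAverage ℝ gaussNE f n (x, 0) : ℝ) : EReal)) atTop ≤ c := by
  set φ : ℝ → EReal := fun x =>
    limsup (fun n => ((birkhoffAverage ℝ gaussNE f n (x, 0) : ℝ) : EReal)) atTop with hφ
  have hfm : Measurable f := hf.continuous.measurable
  have hSm : ∀ n, Measurable (birkhoffAverage ℝ gaussNE f n) := fun n => by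
    unfold birkhoffAverage birkhoffSum
    simp only [smul_eq_mul]
    refine Measurable.const_mul (Finset.measurable_fun_sum _ fun k _ => ?_) _
    exact hfm.comp (measurable_gaussNE.iterate k)
  have hφm : Measurable φ :=
    Measurable.limsup fun n => measurable_coe_real_ereal.comp
      ((hSm n).comp (measurable_id.prodMk measurable_const))
  have h0 : (0 : ℝ) ∈ Set.Icc (0 : ℝ) 1 := ⟨le_rfl, zero_le_one⟩
  set E : Set ℝ := irrUnit ∩ {x | (c : EReal) < φ x} with hE
  have hEm : MeasurableSet E := measurableSet_irrUnit.inter (measurableSet_lt measurable_const hφm)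
  have hinv : ∀ x ∈ irrUnit, gaussMap x ∈ E → x ∈ E := by
    intro x hx hgx
    refine ⟨hx, ?_⟩
    have hmem := gaussNE_mem (mem_irrUnit_prod_Icc hx h0)
    have : φ (gaussMap x) = φ x :=
      (limsup_birkhoffAverage_gaussNE_eq hf (mem_irrUnit_prod_Icc hgx.1 h0) hmem rfl).trans
        (limsup_birkhoffAverage_gaussNE_apply hb (x, 0))
    exact lt_of_lt_of_eq hgx.2 this
  rcases volume_eq_zero_or_of_gaussMap_preimage_subset hEm Set.inter_subset_left hinv with h | h
  · filter_upwards [measure_eq_zero_iff_ae_notMem.1 h] with x hx hxI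
    by_contra! hlt
    exact hx ⟨hxI, hlt⟩
  · exfalso
    have hint : Integrable f gaussNEMeasure := by
      obtain ⟨C, hC⟩ := hb.exists_norm_le
      exact Integrable.of_bound hfm.aestronglyMeasurable C
        (Eventually.of_forall fun p => hC _ (Set.mem_range_self p))
    have hae : ∀ᵐ p ∂gaussNEMeasure, p.1 ∉ irrUnit \ E :=
      ae_gaussNEMeasure_of_ae_volume
        (Measure.quasiMeasurePreserving_fst.ae (measure_eq_zero_iff_ae_notMem.1 h))
    have hnn := integral_nonneg_of_ae_exists_birkhoffSum_pos measurePreserving_gaussNE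
      (g := fun p => f p - c) (hint.sub (integrable_const c)) (hfm.sub_const c) (by
        filter_upwards [hae, ae_gaussNEMeasure_mem] with p hp hpD
        have hpE : p.1 ∈ E := by
          by_contra hcon
          exact hp ⟨hpD.1, hcon⟩
        have hlt : (c : EReal) < limsup (fun n => ((birkhoffAverage ℝ gaussNE f n p : ℝ) : EReal)) atTop :=
          lt_of_lt_of_eq hpE.2 (limsup_birkhoffAverage_gaussNE_eq hf
            (mem_irrUnit_prod_Icc hpD.1 h0) ⟨hpD.1, irrUnit_subset_Icc hpD.2⟩ rfl)
        obtain ⟨n, hn, hn0⟩ := ((frequently_lt_of_lt_limsup (by isBoundedDefault) hlt).and_eventually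
          (eventually_gt_atTop 0)).exists
        refine ⟨n, ?_⟩
        rw [EReal.coe_lt_coe_iff, birkhoffAverage, smul_eq_mul, inv_mul_eq_div,
          lt_div_iff₀ (by exact_mod_cast hn0)] at hn
        have : birkhoffSum gaussNE (fun p => f p - c) n p = birkhoffSum gaussNE f n p - n * c := by
          simp [birkhoffSum, Finset.sum_sub_distrib]
        rw [this]
        linarith)
    rw [integral_sub hint (integrable_const c), integral_const, smul_eq_mul] at hnn
    linarith

theorem ae_eventually_card_gaussNE_le {C : Set (ℝ × ℝ)} (hC : IsClosed C) :
    ∀ᵐ x ∂(volume : Measure ℝ), x ∈ irrUnit → ∀ ε > 0, ∀ᶠ n : ℕ in atTop,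
      (((Finset.range n).filter fun j => gaussNE^[j + 1] (x, 0) ∈ C).card : ℝ) / n ≤
        gaussNEMeasure.real C / gaussNEMeasure.real Set.univ + ε := by
  have hpos : 0 < gaussNEMeasure.real Set.univ :=
    ENNReal.toReal_pos gaussNEMeasure_univ_ne_zero (measure_ne_top _ _)
  set I := gaussNEMeasure.real C / gaussNEMeasure.real Set.univ with hI
  have key : ∀ m : ℕ, ∀ᵐ x ∂(volume : Measure ℝ), x ∈ irrUnit → ∀ᶠ n : ℕ in atTop,
      (((Finset.range n).filter fun j => gaussNE^[j + 1] (x, 0) ∈ C).card : ℝ) / n ≤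
        I + 2 / (m + 1) := by
    intro m
    have hm : (0 : ℝ) < 1 / (m + 1) := by positivity
    have hδ : ∀ n : ℕ, (0 : ℝ) < 1 / ((n : ℝ) + 1) := fun n => by positivity
    have hlim := tendsto_lintegral_thickenedIndicator_of_isClosed gaussNEMeasure hC hδ
      tendsto_one_div_add_atTop_nhds_zero_nat
    have hlim' := (ENNReal.tendsto_toReal (measure_ne_top gaussNEMeasure C)).comp hlim
    have hlt : (gaussNEMeasure C).toReal < (I + 1 / (m + 1)) * gaussNEMeasure.real Set.univ := by
      rw [add_mul, hI, div_mul_cancel₀ _ hpos.ne']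
      have := mul_pos hm hpos
      change gaussNEMeasure.real C < _
      linarith
    obtain ⟨N, hN⟩ := (hlim'.eventually_lt_const hlt).exists
    set f : ℝ × ℝ → ℝ := fun p => (thickenedIndicator (hδ N) C p : ℝ) with hf
    have hflip : LipschitzWith (1 / ((N : ℝ) + 1)).toNNReal⁻¹ f := by
      refine LipschitzWith.of_dist_le_mul fun p q => ?_
      exact (lipschitzWith_thickenedIndicator (hδ N) C).dist_le_mul p q
    have hf1 : ∀ p, f p ≤ 1 := fun p =>
      NNReal.coe_le_coe.2 (thickenedIndicator_le_one (hδ N) C p)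
    have hf0 : ∀ p, 0 ≤ f p := fun p => NNReal.coe_nonneg _
    have hfC : ∀ p ∈ C, f p = 1 := fun p hp =>
      congrArg NNReal.toReal (thickenedIndicator_one (hδ N) C hp)
    have hfb : Bornology.IsBounded (Set.range f) := by
      refine (Metric.isBounded_Icc (0 : ℝ) 1).subset ?_
      rintro _ ⟨p, rfl⟩
      exact ⟨hf0 p, hf1 p⟩
    have hfint : ∫ p, f p ∂gaussNEMeasure < (I + 1 / (m + 1)) * gaussNEMeasure.real Set.univ := by
      rw [integral_eq_lintegral_of_nonneg_ae (Eventually.of_forall hf0)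
        hflip.continuous.aestronglyMeasurable]
      simpa [hf] using hN
    filter_upwards [ae_limsup_birkhoffAverage_gaussNE_le hflip hfb hfint] with x hx hxI
    have h1 := hx hxI
    rw [← limsup_birkhoffAverage_gaussNE_apply hfb] at h1
    have h2 : ((I + 1 / (m + 1) : ℝ) : EReal) < ((I + 2 / (m + 1) : ℝ) : EReal) := by
      rw [EReal.coe_lt_coe_iff]
      have : (2 : ℝ) / (m + 1) = 2 * (1 / (m + 1)) := by ring
      linarith
    filter_upwards [eventually_lt_of_limsup_lt (h1.trans_lt h2)] with n hn
    rw [EReal.coe_lt_coe_iff, birkhoffAverage, smul_eq_mul, inv_mul_eq_div] at hn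
    refine le_trans ?_ hn.le
    gcongr
    rw [Finset.card_filter, Nat.cast_sum, birkhoffSum]
    refine Finset.sum_le_sum fun j _ => ?_
    rw [← Function.iterate_succ_apply]
    by_cases hj : gaussNE^[j + 1] (x, 0) ∈ C
    · rw [if_pos hj, hfC _ hj]; simp
    · rw [if_neg hj]; simpa using hf0 _
  rw [← ae_all_iff] at key
  filter_upwards [key] with x hx hxI ε hε
  obtain ⟨m, hm⟩ := exists_nat_one_div_lt (half_pos hε)
  filter_upwards [hx m hxI] with n hn
  refine hn.trans ?_
  have : (2 : ℝ) / (m + 1) = 2 * (1 / (m + 1)) := by ring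
  linarith

/-! ### Approximation coefficients of the mediants in natural extension coordinates -/

theorem gaussNE_iterate_zero_right {x : ℝ} (hx : x ∈ irrUnit) (n : ℕ) :
    gaussNE^[n] (x, 0) = (gaussMap^[n] x, (qden x n : ℝ) / qden x (n + 1)) := by
  induction n with
  | zero => simp [qden]
  | succ n ih =>
    have hq : (0 : ℝ) < qden x (n + 1) := by exact_mod_cast (qden_nonneg hx n).2
    rw [Function.iterate_succ_apply', Function.iterate_succ_apply', ih]
    simp only [gaussNE, Prod.mk.injEq, true_and]
    change 1 / ((pquot x n : ℝ) + _) = _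
    have : qden x (n + 1 + 1) = pquot x n * qden x (n + 1) + qden x n := rfl
    rw [this]
    push_cast
    rw [eq_div_iff, div_mul_eq_mul_div, div_eq_iff]
    · field_simp
    · have h1 : (1 : ℝ) ≤ pquot x n := by exact_mod_cast one_le_pquot hx n
      have h2 : (0 : ℝ) ≤ qden x n := by exact_mod_cast (qden_nonneg hx n).1
      positivity
    · have h1 : (1 : ℝ) ≤ pquot x n := by exact_mod_cast one_le_pquot hx n
      have h2 : (0 : ℝ) ≤ qden x n := by exact_mod_cast (qden_nonneg hx n).1
      positivity

theorem medTheta_eq {x : ℝ} (hx : x ∈ irrUnit) (l : ℤ) (hl : 0 ≤ l) (j : ℕ)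
    (hlj : l ≤ pquot x j) :
    medTheta x l j = (l + (qden x j : ℝ) / qden x (j + 1)) * (1 - l * gaussMap^[j] x) /
      (1 + gaussMap^[j] x * ((qden x j : ℝ) / qden x (j + 1))) := by
  have ht := gaussMap_iterate_mem_irrUnit hx j
  have hb := gaussBranch_gaussMap_iterate hx j
  have hp := pquot_add x j
  have hdet : (pnum x j : ℝ) * qden x (j + 1) - pnum x (j + 1) * qden x j = (-1) ^ j := by
    exact_mod_cast pnum_qden_det x j
  have hq : (0 : ℝ) < qden x (j + 1) := by exact_mod_cast (qden_nonneg hx j).2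
  have hq0 : (0 : ℝ) ≤ qden x j := by exact_mod_cast (qden_nonneg hx j).1
  have ht' := gaussMap_iterate_mem_irrUnit hx (j + 1)
  set t := gaussMap^[j] x
  have ht0 : 0 < t := ht.1.1
  have hlt : (l : ℝ) * t ≤ 1 := by
    have h1 : (l : ℝ) ≤ pquot x j := by exact_mod_cast hlj
    have h2 : (l : ℝ) ≤ 1 / t := by linarith [ht'.1.1]
    rwa [le_div_iff₀ ht0] at h2
  have hl' : (0 : ℝ) ≤ l := by exact_mod_cast hl
  unfold gaussBranch at hb
  have hD : 0 < (qden x (j + 1) : ℝ) + t * qden x j := by positivity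
  rw [div_eq_iff hD.ne'] at hb
  have key : (((l * qden x (j + 1) + qden x j : ℤ) : ℝ) * x - (l * pnum x (j + 1) + pnum x j : ℤ))
      = -((-1) ^ j * (1 - l * t) / (qden x (j + 1) + t * qden x j)) := by
    rw [← neg_div, eq_div_iff hD.ne', ← hdet]
    push_cast
    linear_combination (-((l : ℝ) * qden x (j + 1) + qden x j)) * hb
  unfold medTheta Theta
  rw [key, abs_neg, abs_div, abs_mul, abs_pow, abs_neg, abs_one, one_pow, one_mul,
    abs_of_nonneg (by linarith), abs_of_pos hD]
  push_cast
  field_simp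

theorem medTheta_sub_eq {x : ℝ} (hx : x ∈ irrUnit) (a j : ℕ) (haj : (a : ℤ) < pquot x j) :
    medTheta x (pquot x j - a) j =
      (1 - a * (gaussNE^[j + 1] (x, 0)).2) * ((gaussNE^[j + 1] (x, 0)).1 + a) /
        (1 + (gaussNE^[j + 1] (x, 0)).1 * (gaussNE^[j + 1] (x, 0)).2) := by
  rw [medTheta_eq hx _ (by omega) _ (by omega), Function.iterate_succ_apply',
    gaussNE_iterate_zero_right hx]
  have ht := gaussMap_iterate_mem_irrUnit hx j
  have ht' := gaussMap_iterate_mem_irrUnit hx (j + 1)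
  have hp := pquot_add x j
  have hq : (0 : ℝ) < qden x (j + 1) := by exact_mod_cast (qden_nonneg hx j).2
  have hq0 : (0 : ℝ) ≤ qden x j := by exact_mod_cast (qden_nonneg hx j).1
  have h1 : (1 : ℝ) ≤ pquot x j := by exact_mod_cast one_le_pquot hx j
  simp only [gaussNE]
  change _ = (1 - a * (1 / ((pquot x j : ℝ) + _))) * (gaussMap (gaussMap^[j] x) + a) /
    (1 + gaussMap (gaussMap^[j] x) * (1 / ((pquot x j : ℝ) + _)))
  rw [← Function.iterate_succ_apply' gaussMap]
  have hv : 0 ≤ (qden x j : ℝ) / qden x (j + 1) := by positivity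
  generalize (qden x j : ℝ) / qden x (j + 1) = v at hv
  have hs0 := ht'.1.1
  have ht0 := ht.1.1
  rw [Nat.succ_eq_add_one]
  generalize gaussMap^[j + 1] x = s at *
  generalize gaussMap^[j] x = t at *
  obtain rfl : t = 1 / ((pquot x j : ℝ) + s) := by rw [hp, one_div_one_div]
  push_cast
  have : 0 < (pquot x j : ℝ) + s := by linarith
  have : 0 < (pquot x j : ℝ) + v := by linarith
  field_simp
  ring

theorem gaussNE_iterate_succ_snd_le {x : ℝ} (hx : x ∈ irrUnit) {a j : ℕ}
    (haj : (a : ℤ) < pquot x j) : (gaussNE^[j + 1] (x, 0)).2 ≤ 1 / (a + 1) := by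
  have hm := gaussNE_iterate_mem (mem_irrUnit_prod_Icc hx ⟨le_rfl, zero_le_one⟩) j
  rw [Function.iterate_succ_apply']
  simp only [gaussNE, gaussNE_iterate_fst]
  change 1 / ((pquot x j : ℝ) + _) ≤ _
  have : (a : ℝ) + 1 ≤ pquot x j := by exact_mod_cast haj
  exact one_div_le_one_div_of_le (by positivity) (by linarith [hm.2.1])

theorem le_gaussNE_iterate_succ_snd {x : ℝ} (hx : x ∈ irrUnit) {a j : ℕ}
    (haj : pquot x j ≤ a) : 1 / ((a : ℝ) + 1) ≤ (gaussNE^[j + 1] (x, 0)).2 := by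
  have hm := gaussNE_iterate_mem (mem_irrUnit_prod_Icc hx ⟨le_rfl, zero_le_one⟩) j
  rw [Function.iterate_succ_apply']
  simp only [gaussNE, gaussNE_iterate_fst]
  change _ ≤ 1 / ((pquot x j : ℝ) + _)
  have : (pquot x j : ℝ) ≤ a := by exact_mod_cast haj
  have : (1 : ℝ) ≤ pquot x j := by exact_mod_cast one_le_pquot hx j
  exact one_div_le_one_div_of_le (by linarith [hm.2.1]) (by linarith [hm.2.2])

theorem medTheta_bounds {x : ℝ} (hx : x ∈ irrUnit) {a j : ℕ} (ha : 1 ≤ a)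
    (haj : (a : ℤ) < pquot x j) :
    (a : ℝ) / ((a : ℝ) + 1) < medTheta x (pquot x j - a) j ∧
      medTheta x (pquot x j - a) j < (a : ℝ) + 1 := by
  have hle := gaussNE_iterate_succ_snd_le hx haj
  have hm := gaussNE_iterate_mem (mem_irrUnit_prod_Icc hx ⟨le_rfl, zero_le_one⟩) (j + 1)
  rw [medTheta_sub_eq hx a j haj]
  have ha' : (1 : ℝ) ≤ a := by exact_mod_cast ha
  obtain ⟨⟨⟨h1, h2⟩, -⟩, h3, -⟩ := hm
  generalize (gaussNE^[j + 1] (x, 0)).1 = t at *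
  generalize (gaussNE^[j + 1] (x, 0)).2 = v at *
  rw [le_div_iff₀ (by positivity)] at hle
  have hD : 0 < 1 + t * v := by positivity
  rw [div_lt_div_iff₀ (by positivity) hD, div_lt_iff₀ hD]
  have hv : (a : ℝ) * v ≤ 1 - v := by linarith
  constructor
  · have h4 : 1 ≤ (a + 1) * (1 - a * v) := by nlinarith
    have h5 : 0 < t * (1 - a * v) := mul_pos h1 (by nlinarith)
    nlinarith [mul_le_mul_of_nonneg_right h4 (by linarith : (0 : ℝ) ≤ t + a)]
  · nlinarith [mul_nonneg h1.le h3, mul_nonneg h3 (by linarith : (0 : ℝ) ≤ a)]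

/-! ### Measures of regions given by bounds on `v / (1 + t v)` -/

theorem integral_one_div_one_add_mul_sq {t b c : ℝ} (ht : 0 ≤ t) (hb : 0 ≤ b) (hbc : b ≤ c) :
    ∫ v in b..c, 1 / (1 + t * v) ^ 2 = c / (1 + t * c) - b / (1 + t * b) := by
  have hpos : ∀ v ∈ Set.uIcc b c, 0 < 1 + t * v := fun v hv => by
    rw [Set.uIcc_of_le hbc] at hv
    have := mul_nonneg ht (hb.trans hv.1)
    linarith
  refine intervalIntegral.integral_eq_sub_of_hasDerivAt (f := fun v => v / (1 + t * v))
    (fun v hv => ?_) (ContinuousOn.intervalIntegrable ?_)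
  · have h := (hasDerivAt_id v).div (((hasDerivAt_id v).const_mul t).const_add 1) (hpos v hv).ne'
    exact h.congr_deriv (by simp only [id]; congr 1; ring)
  · exact continuousOn_const.div (by fun_prop) fun v hv => (pow_pos (hpos v hv) 2).ne'

theorem div_one_sub_mul_le_iff {t v g : ℝ} (htv : 0 < 1 + t * v) (htg : 0 < 1 - t * g) :
    g / (1 - t * g) ≤ v ↔ g ≤ v / (1 + t * v) := by
  rw [div_le_iff₀ htg, le_div_iff₀ htv]
  constructor <;> intro h <;> linarith

theorem le_div_one_sub_mul_iff {t v g : ℝ} (htv : 0 < 1 + t * v) (htg : 0 < 1 - t * g) :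
    v ≤ g / (1 - t * g) ↔ v / (1 + t * v) ≤ g := by
  rw [le_div_iff₀ htg, div_le_iff₀ htv]
  constructor <;> intro h <;> linarith

theorem gaussNEMeasure_real_eq_integral {S : Set (ℝ × ℝ)} (hS : MeasurableSet S) {g₁ g₂ : ℝ → ℝ}
    (hg₁ : ContinuousOn g₁ (Set.Icc 0 1)) (hg₂ : ContinuousOn g₂ (Set.Icc 0 1))
    (h0 : ∀ t ∈ Set.Ioo (0 : ℝ) 1, 0 ≤ g₁ t) (h12 : ∀ t ∈ Set.Ioo (0 : ℝ) 1, g₁ t ≤ g₂ t)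
    (h2 : ∀ t ∈ Set.Ioo (0 : ℝ) 1, g₂ t ≤ 1 / (t + 1))
    (hsub : ∀ t ∈ Set.Ioo (0 : ℝ) 1, ∀ v ∈ Set.Ioo (0 : ℝ) 1, (t, v) ∈ S →
      g₁ t ≤ v / (1 + t * v) ∧ v / (1 + t * v) ≤ g₂ t)
    (hsup : ∀ t ∈ Set.Ioo (0 : ℝ) 1, ∀ v ∈ Set.Ioo (0 : ℝ) 1,
      g₁ t < v / (1 + t * v) → v / (1 + t * v) < g₂ t → (t, v) ∈ S) :
    gaussNEMeasure.real S = ∫ t in (0 : ℝ)..1, (g₂ t - g₁ t) := by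
  have hinner : ∀ t ∈ Set.Ioo (0 : ℝ) 1,
      ∫⁻ v in Set.Ioo (0 : ℝ) 1,
        S.indicator (fun p : ℝ × ℝ => ENNReal.ofReal (1 / (1 + p.1 * p.2) ^ 2)) (t, v) =
      ENNReal.ofReal (g₂ t - g₁ t) := by
    intro t ht
    have hg10 := h0 t ht
    have hg12 := h12 t ht
    have ht1 : 0 < t + 1 := by linarith [ht.1]
    have hg21 := h2 t ht
    rw [le_div_iff₀ ht1] at hg21
    have hD2 : 0 < 1 - t * g₂ t := by
      rcases hg10.trans hg12 |>.eq_or_lt with h | h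
      · rw [← h]; simp
      · linarith
    have hD1 : 0 < 1 - t * g₁ t := by
      have := mul_le_mul_of_nonneg_left hg12 ht.1.le
      linarith
    set b := g₁ t / (1 - t * g₁ t) with hb
    set c := g₂ t / (1 - t * g₂ t) with hc
    have hb0 : 0 ≤ b := div_nonneg hg10 hD1.le
    have hc1 : c ≤ 1 := by rw [hc, div_le_one hD2]; linarith
    have hbc : b ≤ c := by
      rw [hb, hc, div_le_div_iff₀ hD1 hD2]
      linarith
    have hpos : ∀ v : ℝ, 0 ≤ v → 0 < 1 + t * v := fun v hv => by
      have := mul_nonneg ht.1.le hv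
      linarith
    have hslice : MeasurableSet {v | (t, v) ∈ S} := measurable_prodMk_left hS
    have hae : ({v | (t, v) ∈ S} ∩ Set.Ioo (0 : ℝ) 1 : Set ℝ) =ᵐ[volume] Set.Ioc b c := by
      have hne : ∀ y : ℝ, ∀ᵐ v ∂(volume : Measure ℝ), v ≠ y := fun y =>
        measure_eq_zero_iff_ae_notMem.1 (measure_singleton y)
      filter_upwards [hne b, hne c] with v hvb hvc
      refine propext ⟨fun ⟨hvS, hv⟩ => ?_, fun hv => ?_⟩
      · obtain ⟨k1, k2⟩ := hsub t ht v hv hvS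
        exact ⟨lt_of_le_of_ne ((div_one_sub_mul_le_iff (hpos v hv.1.le) hD1).2 k1) hvb.symm,
          (le_div_one_sub_mul_iff (hpos v hv.1.le) hD2).2 k2⟩
      · have hvc' : v < c := lt_of_le_of_ne hv.2 hvc
        have hv01 : v ∈ Set.Ioo (0 : ℝ) 1 := ⟨hb0.trans_lt hv.1, hvc'.trans_le hc1⟩
        refine ⟨hsup t ht v hv01 ?_ ?_, hv01⟩
        · exact not_le.1 fun h => not_le.2 hv.1 ((le_div_one_sub_mul_iff (hpos v hv01.1.le) hD1).2 h)
        · exact not_le.1 fun h => not_le.2 hvc' ((div_one_sub_mul_le_iff (hpos v hv01.1.le) hD2).2 h)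
    have hind : (fun v => S.indicator
        (fun p : ℝ × ℝ => ENNReal.ofReal (1 / (1 + p.1 * p.2) ^ 2)) (t, v)) =
        {v | (t, v) ∈ S}.indicator fun v => ENNReal.ofReal (1 / (1 + t * v) ^ 2) := rfl
    rw [hind, setLIntegral_indicator hslice, Measure.restrict_congr_set hae,
      ← ofReal_integral_eq_lintegral_ofReal, ← intervalIntegral.integral_of_le hbc,
      integral_one_div_one_add_mul_sq ht.1.le hb0 hbc]
    · congr 1
      rw [hb, hc]
      have e1 : ∀ g : ℝ, 0 < 1 - t * g → g / (1 - t * g) / (1 + t * (g / (1 - t * g))) = g := by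
        intro g hg
        have : 1 + t * (g / (1 - t * g)) = 1 / (1 - t * g) := by
          field_simp
          ring
        rw [this, div_div_div_cancel_right₀ hg.ne', div_one]
      rw [e1 _ hD1, e1 _ hD2]
    · refine (intervalIntegrable_iff_integrableOn_Ioc_of_le hbc).1 ?_
      refine ContinuousOn.intervalIntegrable (continuousOn_const.div (by fun_prop) fun v hv => ?_)
      rw [Set.uIcc_of_le hbc] at hv
      exact (pow_pos (hpos v (hb0.trans hv.1)) 2).ne'
    · exact Eventually.of_forall fun v => by positivity
  have hmeas : Measurable fun p : ℝ × ℝ => ENNReal.ofReal (1 / (1 + p.1 * p.2) ^ 2) :=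
    measurable_gaussNE_density
  have hcont : ContinuousOn (fun t => g₂ t - g₁ t) (Set.Icc 0 1) := hg₂.sub hg₁
  have hint : IntegrableOn (fun t => g₂ t - g₁ t) (Set.Ioo 0 1) :=
    (hcont.integrableOn_compact isCompact_Icc).mono_set Set.Ioo_subset_Icc_self
  have hnn : 0 ≤ᵐ[volume.restrict (Set.Ioo (0 : ℝ) 1)] fun t => g₂ t - g₁ t := by
    filter_upwards [ae_restrict_mem measurableSet_Ioo] with t ht
    exact sub_nonneg.2 (h12 t ht)
  rw [Measure.real, gaussNEMeasure, withDensity_apply _ hS, ← lintegral_indicator hS,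
    Measure.volume_eq_prod, ← Measure.prod_restrict, Measure.restrict_congr_set irrUnit_ae_eq,
    lintegral_prod _ (hmeas.indicator hS).aemeasurable,
    setLIntegral_congr_fun measurableSet_Ioo hinner, ← ofReal_integral_eq_lintegral_ofReal hint hnn,
    ENNReal.toReal_ofReal (integral_nonneg_of_ae hnn), intervalIntegral.integral_of_le zero_le_one,
    integral_Ioc_eq_integral_Ioo]

/-- For fixed `t`, the value of `v / (1 + t v)` at which the mediant coefficient equals `z`,
truncated to the range where the partial quotient exceeds `a`. -/
noncomputable def mediantCut (a : ℕ) (z t : ℝ) : ℝ :=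
  min (1 / (t + a + 1)) (max 0 ((t + a - z) / (t + a) ^ 2))

/-- Points of the natural extension at which the partial quotient exceeds `a` and the mediant
coefficient is at most `z`. -/
def mediantLe (a : ℕ) (z : ℝ) : Set (ℝ × ℝ) :=
  {p | p ∈ Set.Icc (0 : ℝ) 1 ×ˢ Set.Icc (0 : ℝ) 1 ∧ p.2 * (a + 1) ≤ 1 ∧
    (1 - a * p.2) * (p.1 + a) ≤ z * (1 + p.1 * p.2)}

/-- Points of the natural extension at which the partial quotient exceeds `a` and the mediant
coefficient is at least `z`. -/
def mediantGe (a : ℕ) (z : ℝ) : Set (ℝ × ℝ) :=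
  {p | p ∈ Set.Icc (0 : ℝ) 1 ×ˢ Set.Icc (0 : ℝ) 1 ∧ p.2 * (a + 1) ≤ 1 ∧
    z * (1 + p.1 * p.2) ≤ (1 - a * p.2) * (p.1 + a)}

/-- Points of the natural extension at which the partial quotient is at most `a`. -/
def quotientLe (a : ℕ) : Set (ℝ × ℝ) := {p | 1 ≤ p.2 * (a + 1)}

theorem isClosed_mediantLe (a : ℕ) (z : ℝ) : IsClosed (mediantLe a z) := by
  have h1 : IsClosed {p : ℝ × ℝ | p.2 * ((a : ℝ) + 1) ≤ 1} :=
    isClosed_le (by fun_prop) continuous_const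
  have h2 : IsClosed {p : ℝ × ℝ | (1 - a * p.2) * (p.1 + a) ≤ z * (1 + p.1 * p.2)} :=
    isClosed_le (by fun_prop) (by fun_prop)
  exact (isClosed_Icc.prod isClosed_Icc).inter (h1.inter h2)

theorem isClosed_mediantGe (a : ℕ) (z : ℝ) : IsClosed (mediantGe a z) := by
  have h1 : IsClosed {p : ℝ × ℝ | p.2 * ((a : ℝ) + 1) ≤ 1} :=
    isClosed_le (by fun_prop) continuous_const
  have h2 : IsClosed {p : ℝ × ℝ | z * (1 + p.1 * p.2) ≤ (1 - a * p.2) * (p.1 + a)} :=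
    isClosed_le (by fun_prop) (by fun_prop)
  exact (isClosed_Icc.prod isClosed_Icc).inter (h1.inter h2)

theorem isClosed_quotientLe (a : ℕ) : IsClosed (quotientLe a) :=
  isClosed_le continuous_const (by fun_prop)

theorem mul_add_one_le_iff {a : ℕ} {t v : ℝ} (ht : 0 ≤ t) (hv : 0 ≤ v) :
    v * (a + 1) ≤ 1 ↔ v / (1 + t * v) ≤ 1 / (t + a + 1) := by
  rw [div_le_div_iff₀ (by positivity) (by positivity)]
  constructor <;> intro h <;> linarith

theorem mediant_le_iff {a : ℕ} (ha : 1 ≤ a) {t v z : ℝ} (ht : 0 ≤ t) (hv : 0 ≤ v) :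
    (1 - a * v) * (t + a) ≤ z * (1 + t * v) ↔
      (t + a - z) / (t + a) ^ 2 ≤ v / (1 + t * v) := by
  have ha' : (1 : ℝ) ≤ a := by exact_mod_cast ha
  have hu : 0 < t + (a : ℝ) := by linarith
  rw [div_le_div_iff₀ (by positivity) (by positivity)]
  constructor <;> intro h <;> nlinarith

theorem le_mediant_iff {a : ℕ} (ha : 1 ≤ a) {t v z : ℝ} (ht : 0 ≤ t) (hv : 0 ≤ v) :
    z * (1 + t * v) ≤ (1 - a * v) * (t + a) ↔
      v / (1 + t * v) ≤ (t + a - z) / (t + a) ^ 2 := by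
  have ha' : (1 : ℝ) ≤ a := by exact_mod_cast ha
  have hu : 0 < t + (a : ℝ) := by linarith
  rw [div_le_div_iff₀ (by positivity) (by positivity)]
  constructor <;> intro h <;> nlinarith

theorem continuousOn_mediantCut {a : ℕ} (ha : 1 ≤ a) (z : ℝ) :
    ContinuousOn (mediantCut a z) (Set.Icc 0 1) := by
  have ha' : (1 : ℝ) ≤ a := by exact_mod_cast ha
  refine ContinuousOn.inf (continuousOn_const.div (by fun_prop) fun t ht => ?_)
    (continuousOn_const.sup (ContinuousOn.div (by fun_prop) (by fun_prop) fun t ht => ?_))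
  · linarith [ht.1]
  · have : 0 < t + (a : ℝ) := by linarith [ht.1]
    positivity

theorem continuousOn_one_div_add_add_one (a : ℕ) :
    ContinuousOn (fun t : ℝ => 1 / (t + a + 1)) (Set.Icc 0 1) :=
  continuousOn_const.div (by fun_prop) fun t ht => by have := ht.1; positivity

theorem continuousOn_one_div_add_one :
    ContinuousOn (fun t : ℝ => 1 / (t + 1)) (Set.Icc 0 1) :=
  continuousOn_const.div (by fun_prop) fun t ht => by have := ht.1; positivity

theorem mediantCut_nonneg (a : ℕ) (z : ℝ) {t : ℝ} (ht : 0 ≤ t) : 0 ≤ mediantCut a z t :=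
  le_min (by positivity) (le_max_left _ _)

theorem mediantCut_le (a : ℕ) (z t : ℝ) : mediantCut a z t ≤ 1 / (t + a + 1) := min_le_left _ _

theorem one_div_add_add_one_le (a : ℕ) {t : ℝ} (ht : 0 ≤ t) :
    1 / (t + a + 1) ≤ 1 / (t + 1) :=
  one_div_le_one_div_of_le (by positivity) (by linarith [(Nat.cast_nonneg a : (0 : ℝ) ≤ a)])

theorem gaussNEMeasure_real_mediantLe {a : ℕ} (ha : 1 ≤ a) (z : ℝ) :
    gaussNEMeasure.real (mediantLe a z) =
      ∫ t in (0 : ℝ)..1, (1 / (t + a + 1) - mediantCut a z t) := by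
  refine gaussNEMeasure_real_eq_integral (isClosed_mediantLe a z).measurableSet
    (continuousOn_mediantCut ha z) (continuousOn_one_div_add_add_one a)
    (fun t ht => mediantCut_nonneg a z ht.1.le) (fun t _ => mediantCut_le a z t)
    (fun t ht => one_div_add_add_one_le a ht.1.le) (fun t ht v hv h => ?_) fun t ht v hv h1 h2 => ?_
  · have hw : 0 ≤ v / (1 + t * v) :=
      div_nonneg hv.1.le (by linarith [mul_nonneg ht.1.le hv.1.le])
    exact ⟨(min_le_right _ _).trans (max_le hw ((mediant_le_iff ha ht.1.le hv.1.le).1 h.2.2)),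
      (mul_add_one_le_iff ht.1.le hv.1.le).1 h.2.1⟩
  · refine ⟨⟨Set.Ioo_subset_Icc_self ht, Set.Ioo_subset_Icc_self hv⟩,
      (mul_add_one_le_iff ht.1.le hv.1.le).2 h2.le, (mediant_le_iff ha ht.1.le hv.1.le).2 ?_⟩
    rcases min_lt_iff.1 h1 with h | h
    · exact absurd h2 h.not_gt
    · exact (max_lt_iff.1 h).2.le

theorem gaussNEMeasure_real_mediantGe {a : ℕ} (ha : 1 ≤ a) (z : ℝ) :
    gaussNEMeasure.real (mediantGe a z) = ∫ t in (0 : ℝ)..1, (mediantCut a z t - 0) := by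
  refine gaussNEMeasure_real_eq_integral (isClosed_mediantGe a z).measurableSet
    continuousOn_const (continuousOn_mediantCut ha z)
    (fun t ht => le_rfl) (fun t ht => mediantCut_nonneg a z ht.1.le)
    (fun t ht => (mediantCut_le a z t).trans (one_div_add_add_one_le a ht.1.le))
    (fun t ht v hv h => ?_) fun t ht v hv h1 h2 => ?_
  · have hw : 0 ≤ v / (1 + t * v) :=
      div_nonneg hv.1.le (by linarith [mul_nonneg ht.1.le hv.1.le])
    exact ⟨hw, le_min ((mul_add_one_le_iff ht.1.le hv.1.le).1 h.2.1)
      (le_max_of_le_right ((le_mediant_iff ha ht.1.le hv.1.le).1 h.2.2))⟩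
  · obtain ⟨h3, h4⟩ := lt_min_iff.1 h2
    refine ⟨⟨Set.Ioo_subset_Icc_self ht, Set.Ioo_subset_Icc_self hv⟩,
      (mul_add_one_le_iff ht.1.le hv.1.le).2 h3.le, (le_mediant_iff ha ht.1.le hv.1.le).2 ?_⟩
    rcases lt_max_iff.1 h4 with h | h
    · exact absurd h1 h.not_gt
    · exact h.le

theorem gaussNEMeasure_real_quotientLe (a : ℕ) :
    gaussNEMeasure.real (quotientLe a) =
      ∫ t in (0 : ℝ)..1, (1 / (t + 1) - 1 / (t + a + 1)) := by
  refine gaussNEMeasure_real_eq_integral (isClosed_quotientLe a).measurableSet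
    (continuousOn_one_div_add_add_one a) continuousOn_one_div_add_one
    (fun t ht => by have := ht.1; positivity) (fun t ht => one_div_add_add_one_le a ht.1.le)
    (fun t ht => le_rfl) (fun t ht v hv h => ?_) fun t ht v hv h1 h2 => ?_
  · have := ht.1
    have := hv.1
    have h' : 1 ≤ v * (a + 1) := h
    rw [div_le_div_iff₀ (by positivity) (by positivity),
      div_le_div_iff₀ (by positivity) (by positivity)]
    constructor <;> linarith [hv.2]
  · exact (not_le.1 fun h => not_le.2 h1 ((mul_add_one_le_iff ht.1.le hv.1.le).1 h)).le

theorem gaussNEMeasure_real_univ :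
    gaussNEMeasure.real Set.univ = ∫ t in (0 : ℝ)..1, (1 / (t + 1) - 0) := by
  refine gaussNEMeasure_real_eq_integral MeasurableSet.univ
    continuousOn_const continuousOn_one_div_add_one
    (fun t ht => le_rfl) (fun t ht => by have := ht.1; positivity)
    (fun t ht => le_rfl) (fun t ht v hv h => ?_) fun t ht v hv h1 h2 => trivial
  have := ht.1
  have := hv.1
  rw [div_le_div_iff₀ (by positivity) (by positivity)]
  exact ⟨by positivity, by linarith [hv.2]⟩

theorem integral_one_div_add_add_one (a : ℕ) :
    ∫ t in (0 : ℝ)..1, 1 / (t + a + 1) = Real.log (((a : ℝ) + 2) / ((a : ℝ) + 1)) := by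
  have h := intervalIntegral.integral_comp_add_right (a := 0) (b := 1) (fun u : ℝ => 1 / u)
    ((a : ℝ) + 1)
  simp only [← add_assoc] at h
  rw [h, integral_one_div_of_pos (by positivity) (by positivity)]
  congr 2 <;> ring

theorem intervalIntegrable_mediantCut {a : ℕ} (ha : 1 ≤ a) (z : ℝ) :
    IntervalIntegrable (mediantCut a z) volume 0 1 :=
  ContinuousOn.intervalIntegrable (by
    rw [Set.uIcc_of_le zero_le_one]; exact continuousOn_mediantCut ha z)

theorem intervalIntegrable_one_div_add_add_one (a : ℕ) :
    IntervalIntegrable (fun t : ℝ => 1 / (t + a + 1)) volume 0 1 :=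
  ContinuousOn.intervalIntegrable (by
    rw [Set.uIcc_of_le zero_le_one]; exact continuousOn_one_div_add_add_one a)

theorem intervalIntegrable_one_div_add_one :
    IntervalIntegrable (fun t : ℝ => 1 / (t + 1)) volume 0 1 :=
  ContinuousOn.intervalIntegrable (by
    rw [Set.uIcc_of_le zero_le_one]; exact continuousOn_one_div_add_one)

theorem gaussNEMeasure_real_mediantLe_add_mediantGe {a : ℕ} (ha : 1 ≤ a) (z : ℝ) :
    gaussNEMeasure.real (mediantLe a z) + gaussNEMeasure.real (mediantGe a z) =
      Real.log (((a : ℝ) + 2) / ((a : ℝ) + 1)) := by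
  rw [gaussNEMeasure_real_mediantLe ha, gaussNEMeasure_real_mediantGe ha,
    intervalIntegral.integral_sub (intervalIntegrable_one_div_add_add_one a)
      (intervalIntegrable_mediantCut ha z), integral_one_div_add_add_one]
  simp

theorem gaussNEMeasure_real_quotientLe_add (a : ℕ) :
    gaussNEMeasure.real (quotientLe a) + Real.log (((a : ℝ) + 2) / ((a : ℝ) + 1)) =
      gaussNEMeasure.real Set.univ := by
  rw [gaussNEMeasure_real_quotientLe, gaussNEMeasure_real_univ,
    intervalIntegral.integral_sub intervalIntegrable_one_div_add_one
      (intervalIntegrable_one_div_add_add_one a), integral_one_div_add_add_one]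
  simp

/-! ### The limiting distribution function -/

theorem integral_one_div_sub_div_sq {p q z : ℝ} (hp : 0 < p) (hpq : p ≤ q) :
    ∫ u in p..q, (1 / (u + 1) - (u - z) / u ^ 2) =
      Real.log (q + 1) - Real.log q - z / q - (Real.log (p + 1) - Real.log p - z / p) := by
  have hpos : ∀ u ∈ Set.uIcc p q, 0 < u := fun u hu => by
    rw [Set.uIcc_of_le hpq] at hu
    exact hp.trans_le hu.1
  refine intervalIntegral.integral_eq_sub_of_hasDerivAt
    (f := fun u => Real.log (u + 1) - Real.log u - z / u) (fun u hu => ?_)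
    (ContinuousOn.intervalIntegrable ?_)
  · have hu0 := hpos u hu
    have h := ((((hasDerivAt_id u).add_const 1).log (by simp only [id]; linarith)).sub
      ((hasDerivAt_id u).log hu0.ne')).sub ((hasDerivAt_inv hu0.ne').const_mul z)
    refine h.congr_deriv ?_
    simp only [id]
    have : 0 < u + 1 := by linarith
    field_simp
    ring
  · refine (continuousOn_const.div (by fun_prop) fun u hu => ?_).sub
      (ContinuousOn.div (by fun_prop) (by fun_prop) fun u hu => ?_)
    · linarith [hpos u hu]
    · exact (pow_pos (hpos u hu) 2).ne'

theorem gaussNEMeasure_real_mediantLe_eq_integral {a : ℕ} (ha : 1 ≤ a) (z : ℝ) :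
    gaussNEMeasure.real (mediantLe a z) = ∫ u in (a : ℝ)..(a + 1),
      (1 / (u + 1) - min (1 / (u + 1)) (max 0 ((u - z) / u ^ 2))) := by
  have h := intervalIntegral.integral_comp_add_right (a := 0) (b := 1)
    (fun u : ℝ => 1 / (u + 1) - min (1 / (u + 1)) (max 0 ((u - z) / u ^ 2))) (a : ℝ)
  rw [zero_add, add_comm (1 : ℝ)] at h
  rw [gaussNEMeasure_real_mediantLe ha, ← h]
  rfl

theorem intervalIntegrable_mediantCut_comp {p q : ℝ} (hp : 0 < p) (hpq : p ≤ q) (z : ℝ) :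
    IntervalIntegrable
      (fun u : ℝ => 1 / (u + 1) - min (1 / (u + 1)) (max 0 ((u - z) / u ^ 2))) volume p q := by
  have hpos : ∀ u ∈ Set.uIcc p q, 0 < u := fun u hu => by
    rw [Set.uIcc_of_le hpq] at hu
    exact hp.trans_le hu.1
  have h1 : ContinuousOn (fun u : ℝ => 1 / (u + 1)) (Set.uIcc p q) :=
    continuousOn_const.div (by fun_prop) fun u hu => by linarith [hpos u hu]
  refine (h1.sub (h1.inf (continuousOn_const.sup
    (ContinuousOn.div (by fun_prop) (by fun_prop) fun u hu => ?_)))).intervalIntegrable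
  exact (pow_pos (hpos u hu) 2).ne'

theorem sub_div_sq_le_iff {u z : ℝ} (hu : 0 < u) :
    (u - z) / u ^ 2 ≤ 1 / (u + 1) ↔ u * (1 - z) ≤ z := by
  rw [div_le_div_iff₀ (by positivity) (by positivity)]
  constructor <;> intro h <;> nlinarith

theorem integral_mediantCut_comp_of_mem {p q z : ℝ} (hp : 0 < p) (hpq : p ≤ q) (hz : z ≤ p)
    (hq : ∀ u ∈ Set.Icc p q, u * (1 - z) ≤ z) :
    ∫ u in p..q, (1 / (u + 1) - min (1 / (u + 1)) (max 0 ((u - z) / u ^ 2))) =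
      Real.log (q + 1) - Real.log q - z / q - (Real.log (p + 1) - Real.log p - z / p) := by
  rw [← integral_one_div_sub_div_sq hp hpq]
  refine intervalIntegral.integral_congr fun u hu => ?_
  rw [Set.uIcc_of_le hpq] at hu
  have hu0 : 0 < u := hp.trans_le hu.1
  rw [max_eq_right (div_nonneg (by linarith [hu.1]) (by positivity)),
    min_eq_right ((sub_div_sq_le_iff hu0).2 (hq u hu))]

theorem gaussNEMeasure_real_mediantLe_of_le {a : ℕ} (ha : 1 ≤ a) {z : ℝ}
    (hz : (a : ℝ) / (a + 1) ≤ z) (hz' : z ≤ ((a : ℝ) + 1) / (a + 2)) :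
    gaussNEMeasure.real (mediantLe a z) =
      ((a : ℝ) + 1) * z / a - 1 + Real.log ((a : ℝ) / ((a + 1) * z)) := by
  have ha' : (1 : ℝ) ≤ a := by exact_mod_cast ha
  rw [div_le_iff₀ (by positivity)] at hz
  rw [le_div_iff₀ (by positivity)] at hz'
  have hz1 : 0 < 1 - z := by nlinarith
  have hz0 : 0 < z := by nlinarith
  set m := z / (1 - z) with hm
  have ham : (a : ℝ) ≤ m := by rw [hm, le_div_iff₀ hz1]; linarith
  have hma : m ≤ a + 1 := by rw [hm, div_le_iff₀ hz1]; linarith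
  have hmz : m * (1 - z) = z := div_mul_cancel₀ _ hz1.ne'
  have ha0 : (0 : ℝ) < a := by linarith
  have hm0 : 0 < m := by linarith
  have h2 : ∫ u in m..((a : ℝ) + 1),
      (1 / (u + 1) - min (1 / (u + 1)) (max 0 ((u - z) / u ^ 2))) = 0 := by
    refine (intervalIntegral.integral_congr (g := fun _ => 0) fun u hu => ?_).trans (by simp)
    rw [Set.uIcc_of_le hma] at hu
    have hu0 : 0 < u := hm0.trans_le hu.1
    have h3 : 1 / (u + 1) ≤ (u - z) / u ^ 2 := by
      rw [div_le_div_iff₀ (by positivity) (by positivity)]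
      nlinarith [mul_le_mul_of_nonneg_right hu.1 hz1.le]
    simp only
    rw [min_eq_left (le_max_of_le_right h3), sub_self]
  rw [gaussNEMeasure_real_mediantLe_eq_integral ha,
    ← intervalIntegral.integral_add_adjacent_intervals
      (intervalIntegrable_mediantCut_comp ha0 ham z) (intervalIntegrable_mediantCut_comp hm0 hma z),
    h2, integral_mediantCut_comp_of_mem ha0 ham (by linarith) fun u hu => by
      linarith [mul_le_mul_of_nonneg_right hu.2 hz1.le]]
  have hm1 : m + 1 = m / z := by
    rw [eq_div_iff hz0.ne']
    linarith
  have hzm : z / m = 1 - z := by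
    rw [div_eq_iff hm0.ne']
    linarith
  rw [hm1, hzm, Real.log_div hm0.ne' hz0.ne', Real.log_div ha0.ne' (by positivity),
    Real.log_mul (by positivity) hz0.ne']
  field_simp
  ring

theorem gaussNEMeasure_real_mediantLe_of_mem {a : ℕ} (ha : 1 ≤ a) {z : ℝ}
    (hz : ((a : ℝ) + 1) / (a + 2) ≤ z) (hz' : z ≤ a) :
    gaussNEMeasure.real (mediantLe a z) =
      z / ((a : ℝ) * (a + 1)) + Real.log ((a : ℝ) * (a + 2) / (a + 1) ^ 2) := by
  have ha0 : (0 : ℝ) < a := by exact_mod_cast ha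
  rw [div_le_iff₀ (by positivity)] at hz
  rw [gaussNEMeasure_real_mediantLe_eq_integral ha,
    integral_mediantCut_comp_of_mem ha0 (by linarith) hz' fun u hu => by
      rcases le_or_gt z 1 with h | h
      · linarith [mul_le_mul_of_nonneg_right hu.2 (sub_nonneg.2 h)]
      · nlinarith [hu.1],
    Real.log_div (by positivity) (by positivity), Real.log_mul ha0.ne' (by positivity),
    Real.log_pow, add_assoc (a : ℝ) 1 1, one_add_one_eq_two]
  push_cast
  field_simp
  ring

theorem gaussNEMeasure_real_mediantLe_of_ge {a : ℕ} (ha : 1 ≤ a) {z : ℝ}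
    (hz : (a : ℝ) ≤ z) (hz' : z ≤ a + 1) :
    gaussNEMeasure.real (mediantLe a z) =
      1 - z / ((a : ℝ) + 1) + Real.log (((a : ℝ) + 2) * z / (a + 1) ^ 2) := by
  have ha' : (1 : ℝ) ≤ a := by exact_mod_cast ha
  have ha0 : (0 : ℝ) < a := by linarith
  have hz0 : 0 < z := by linarith
  have h1 : ∫ u in (a : ℝ)..z,
      (1 / (u + 1) - min (1 / (u + 1)) (max 0 ((u - z) / u ^ 2))) =
      Real.log (z + 1) - Real.log (a + 1) := by
    rw [← Real.log_div (by positivity) (by positivity),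
      ← integral_one_div_of_pos (by positivity) (by positivity),
      ← intervalIntegral.integral_comp_add_right (fun u : ℝ => 1 / u)]
    refine intervalIntegral.integral_congr fun u hu => ?_
    rw [Set.uIcc_of_le hz] at hu
    have hu0 : 0 < u := ha0.trans_le hu.1
    rw [max_eq_left (div_nonpos_of_nonpos_of_nonneg (by linarith [hu.2]) (by positivity)),
      min_eq_right (by positivity), sub_zero]
  rw [gaussNEMeasure_real_mediantLe_eq_integral ha,
    ← intervalIntegral.integral_add_adjacent_intervals
      (intervalIntegrable_mediantCut_comp ha0 hz z) (intervalIntegrable_mediantCut_comp hz0 hz' z),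
    h1, integral_mediantCut_comp_of_mem hz0 hz' le_rfl fun u hu => by nlinarith [hu.1],
    Real.log_div (by positivity) (by positivity), Real.log_mul (by positivity) hz0.ne',
    Real.log_pow, add_assoc (a : ℝ) 1 1, one_add_one_eq_two, div_self hz0.ne']
  push_cast
  ring

theorem dist9_eq {a : ℕ} (ha : 1 ≤ a) {z : ℝ} (hz : (a : ℝ) / (a + 1) ≤ z) (hz' : z ≤ a + 1) :
    dist9 a z = gaussNEMeasure.real (mediantLe a z) /
      Real.log (((a : ℝ) + 2) / ((a : ℝ) + 1)) := by
  unfold dist9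
  rw [one_div_mul_eq_div]
  congr 1
  split_ifs with h1 h2
  · exact (gaussNEMeasure_real_mediantLe_of_le ha hz h1).symm
  · exact (gaussNEMeasure_real_mediantLe_of_mem ha (not_le.1 h1).le h2).symm
  · exact (gaussNEMeasure_real_mediantLe_of_ge ha (not_le.1 h2).le hz').symm

theorem continuous_gaussNEMeasure_real_mediantLe {a : ℕ} (ha : 1 ≤ a) :
    Continuous fun z => gaussNEMeasure.real (mediantLe a z) := by
  simp_rw [gaussNEMeasure_real_mediantLe ha]
  refine intervalIntegral.continuous_of_dominated_interval (bound := fun t => 1 / (t + a + 1))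
    (fun z => ?_) (fun z => ?_) (intervalIntegrable_one_div_add_add_one a) ?_
  · exact ((intervalIntegrable_one_div_add_add_one a).sub
      (intervalIntegrable_mediantCut ha z)).aestronglyMeasurable_restrict_uIoc
  · refine Eventually.of_forall fun t ht => ?_
    rw [Set.uIoc_of_le zero_le_one] at ht
    have h1 := mediantCut_nonneg a z ht.1.le
    have h2 := mediantCut_le a z t
    rw [Real.norm_eq_abs, abs_of_nonneg (by linarith)]
    linarith
  · refine Eventually.of_forall fun t _ => ?_
    unfold mediantCut
    fun_prop

theorem log_add_two_div_add_one_pos (a : ℕ) : 0 < Real.log (((a : ℝ) + 2) / ((a : ℝ) + 1)) :=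
  Real.log_pos (by rw [one_lt_div (by positivity)]; linarith)

/-! ### Frequencies along the mediants -/

theorem tendsto_of_eventually_le_of_sum_eq_one {u v w : ℕ → ℝ} {α β γ : ℝ}
    (hu : ∀ ε > 0, ∀ᶠ n in atTop, u n ≤ α + ε) (hv : ∀ ε > 0, ∀ᶠ n in atTop, v n ≤ β + ε)
    (hw : ∀ ε > 0, ∀ᶠ n in atTop, w n ≤ γ + ε) (hsum : ∀ᶠ n in atTop, u n + v n + w n = 1)
    (h : α + β + γ = 1) : Tendsto u atTop (𝓝 α) := by
  refine tendsto_order.2 ⟨fun b hb => ?_, fun b hb => ?_⟩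
  · filter_upwards [hv ((α - b) / 3) (by linarith), hw ((α - b) / 3) (by linarith), hsum]
      with n h1 h2 h3
    linarith
  · filter_upwards [hu ((b - α) / 2) (by linarith)] with n h1
    linarith

theorem card_filter_range_nth {P : ℕ → Prop} [DecidablePred P] (hP : {j | P j}.Infinite)
    (Q : ℕ → Prop) [DecidablePred Q] (n : ℕ) :
    ((Finset.range n).filter fun k => Q (Nat.nth P k)).card =
      ((Finset.range (Nat.nth P n)).filter fun j => P j ∧ Q j).card := by
  rw [← Finset.card_image_of_injective _ (Nat.nth_injective hP)]
  congr 1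
  ext j
  simp only [Finset.mem_image, Finset.mem_filter, Finset.mem_range]
  constructor
  · rintro ⟨k, ⟨hk, hQ⟩, rfl⟩
    exact ⟨Nat.nth_strictMono hP hk, Nat.nth_mem_of_infinite hP k, hQ⟩
  · rintro ⟨hj, hPj, hQj⟩
    refine ⟨Nat.count P j, ⟨?_, ?_⟩, Nat.nth_count hPj⟩
    · rwa [← Nat.nth_lt_nth hP, Nat.nth_count hPj]
    · rwa [Nat.nth_count hPj]

theorem infinite_of_tendsto_card_div {P : ℕ → Prop} [DecidablePred P] {β : ℝ} (hβ : 0 < β)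
    (h : Tendsto (fun n : ℕ => (((Finset.range n).filter P).card : ℝ) / n) atTop (𝓝 β)) :
    {j | P j}.Infinite := by
  intro hfin
  refine hβ.ne' (tendsto_nhds_unique h ?_)
  refine squeeze_zero (fun n => by positivity) (fun n => ?_)
    (tendsto_const_div_atTop_nhds_zero_nat (hfin.toFinset.card : ℝ))
  gcongr
  intro j hj
  simpa using (Finset.mem_filter.1 hj).2

theorem tendsto_card_nth_div {P Q : ℕ → Prop} [DecidablePred P] [DecidablePred Q] {α β : ℝ} (hβ : 0 < β)
    (hP : Tendsto (fun n : ℕ => (((Finset.range n).filter P).card : ℝ) / n) atTop (𝓝 β))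
    (hPQ : Tendsto (fun n : ℕ => (((Finset.range n).filter fun j => P j ∧ Q j).card : ℝ) / n)
      atTop (𝓝 α)) :
    Tendsto (fun n : ℕ => (((Finset.range n).filter fun k => Q (Nat.nth P k)).card : ℝ) / n)
      atTop (𝓝 (α / β)) := by
  have hinf := infinite_of_tendsto_card_div hβ hP
  have hnth : Tendsto (Nat.nth P) atTop atTop := (Nat.nth_strictMono hinf).tendsto_atTop
  refine ((hPQ.comp hnth).div (hP.comp hnth) hβ.ne').congr' ?_
  filter_upwards [hnth.eventually_gt_atTop 0] with n hn
  have hn' : ((Nat.nth P n : ℕ) : ℝ) ≠ 0 := by exact_mod_cast hn.ne'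
  have hcard : ((Finset.range (Nat.nth P n)).filter P).card = n := by
    rw [← Nat.count_eq_card_filter_range, Nat.count_nth_of_infinite hinf]
  simp only [Pi.div_apply, Function.comp_apply]
  rw [card_filter_range_nth hinf Q, div_div_div_cancel_right₀ hn', hcard]

theorem tendsto_of_monotone_of_tendsto_rat {u : ℕ → ℝ → ℝ} {G : ℝ → ℝ}
    (hu : ∀ n, Monotone (u n)) (hG : Continuous G)
    (h : ∀ q : ℚ, Tendsto (fun n => u n q) atTop (𝓝 (G q))) (z : ℝ) :
    Tendsto (fun n => u n z) atTop (𝓝 (G z)) := by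
  refine tendsto_order.2 ⟨fun b hb => ?_, fun b hb => ?_⟩
  · obtain ⟨δ, hδ, hball⟩ := Metric.eventually_nhds_iff.1 ((hG.tendsto z).eventually_const_lt hb)
    obtain ⟨q, hq1, hq2⟩ := exists_rat_btwn (sub_lt_self z hδ)
    have hq : b < G q := hball (by rw [Real.dist_eq, abs_sub_lt_iff]; constructor <;> linarith)
    filter_upwards [(h q).eventually_const_lt hq] with n hn
    exact hn.trans_le (hu n hq2.le)
  · obtain ⟨δ, hδ, hball⟩ := Metric.eventually_nhds_iff.1 ((hG.tendsto z).eventually_lt_const hb)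
    obtain ⟨q, hq1, hq2⟩ := exists_rat_btwn (lt_add_of_pos_right z hδ)
    have hq : G q < b := hball (by rw [Real.dist_eq, abs_sub_lt_iff]; constructor <;> linarith)
    filter_upwards [(h q).eventually_lt_const hq] with n hn
    exact (hu n hq1.le).trans_lt hn

theorem gaussNE_iterate_mem_Icc {x : ℝ} (hx : x ∈ irrUnit) (j : ℕ) :
    gaussNE^[j] (x, 0) ∈ Set.Icc (0 : ℝ) 1 ×ˢ Set.Icc (0 : ℝ) 1 :=
  Set.prod_mono_left irrUnit_subset_Icc
    (gaussNE_iterate_mem (mem_irrUnit_prod_Icc hx ⟨le_rfl, zero_le_one⟩) j)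

theorem gaussNE_iterate_mem_mediantLe {x : ℝ} (hx : x ∈ irrUnit) {a j : ℕ} {z : ℝ}
    (haj : (a : ℤ) < pquot x j) (hz : medTheta x (pquot x j - a) j ≤ z) :
    gaussNE^[j + 1] (x, 0) ∈ mediantLe a z := by
  have hm := gaussNE_iterate_mem_Icc hx (j + 1)
  have hD := mul_nonneg hm.1.1 hm.2.1
  have hle := gaussNE_iterate_succ_snd_le hx haj
  rw [medTheta_sub_eq hx a j haj, div_le_iff₀ (by linarith)] at hz
  rw [le_div_iff₀ (by positivity)] at hle
  exact ⟨hm, hle, hz⟩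

theorem gaussNE_iterate_mem_mediantGe {x : ℝ} (hx : x ∈ irrUnit) {a j : ℕ} {z : ℝ}
    (haj : (a : ℤ) < pquot x j) (hz : z ≤ medTheta x (pquot x j - a) j) :
    gaussNE^[j + 1] (x, 0) ∈ mediantGe a z := by
  have hm := gaussNE_iterate_mem_Icc hx (j + 1)
  have hD := mul_nonneg hm.1.1 hm.2.1
  have hle := gaussNE_iterate_succ_snd_le hx haj
  rw [medTheta_sub_eq hx a j haj, le_div_iff₀ (by linarith)] at hz
  rw [le_div_iff₀ (by positivity)] at hle
  exact ⟨hm, hle, hz⟩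

theorem gaussNE_iterate_mem_quotientLe {x : ℝ} (hx : x ∈ irrUnit) {a j : ℕ}
    (haj : pquot x j ≤ a) : gaussNE^[j + 1] (x, 0) ∈ quotientLe a := by
  have hle := le_gaussNE_iterate_succ_snd hx haj
  rwa [div_le_iff₀ (by positivity)] at hle

theorem eventually_card_div_le_of_imp {p q : ℕ → Prop} [DecidablePred p] [DecidablePred q] {c : ℝ}
    (hpq : ∀ j, p j → q j)
    (hq : ∀ ε > 0, ∀ᶠ n : ℕ in atTop, (((Finset.range n).filter q).card : ℝ) / n ≤ c + ε) :
    ∀ ε > 0, ∀ᶠ n : ℕ in atTop, (((Finset.range n).filter p).card : ℝ) / n ≤ c + ε := by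
  intro ε hε
  filter_upwards [hq ε hε] with n hn
  refine le_trans ?_ hn
  gcongr with j
  exact hpq j

theorem ae_tendsto_mediant_frequencies {a : ℕ} (ha : 1 ≤ a) :
    ∀ᵐ x ∂(volume : Measure ℝ), x ∈ irrUnit →
      Tendsto (fun n : ℕ => (((Finset.range n).filter fun j => (a : ℤ) < pquot x j).card : ℝ) / n)
        atTop (𝓝 (Real.log (((a : ℝ) + 2) / ((a : ℝ) + 1)) / gaussNEMeasure.real Set.univ)) ∧
      ∀ q : ℚ, Tendsto (fun n : ℕ => (((Finset.range n).filter fun j =>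
          (a : ℤ) < pquot x j ∧ medTheta x (pquot x j - a) j ≤ q).card : ℝ) / n)
        atTop (𝓝 (gaussNEMeasure.real (mediantLe a q) / gaussNEMeasure.real Set.univ)) := by
  have hpos : 0 < gaussNEMeasure.real Set.univ :=
    ENNReal.toReal_pos gaussNEMeasure_univ_ne_zero (measure_ne_top _ _)
  filter_upwards [ae_all_iff.2 fun q : ℚ => ae_eventually_card_gaussNE_le (isClosed_mediantLe a q),
    ae_all_iff.2 fun q : ℚ => ae_eventually_card_gaussNE_le (isClosed_mediantGe a q),
    ae_eventually_card_gaussNE_le (isClosed_quotientLe a)] with x h1 h2 h3 hx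
  have k1 := fun q : ℚ => eventually_card_div_le_of_imp
    (p := fun j => (a : ℤ) < pquot x j ∧ medTheta x (pquot x j - a) j ≤ q)
    (fun j hj => gaussNE_iterate_mem_mediantLe hx hj.1 hj.2) (h1 q hx)
  have k2 := fun q : ℚ => eventually_card_div_le_of_imp
    (p := fun j => (a : ℤ) < pquot x j ∧ ¬ medTheta x (pquot x j - a) j ≤ q)
    (fun j hj => gaussNE_iterate_mem_mediantGe hx hj.1 (not_le.1 hj.2).le) (h2 q hx)
  have k3 := eventually_card_div_le_of_imp (p := fun j => ¬ (a : ℤ) < pquot x j)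
    (fun j hj => gaussNE_iterate_mem_quotientLe hx (not_lt.1 hj)) (h3 hx)
  have hcard : ∀ n : ℕ, 0 < n → (((Finset.range n).filter fun j => (a : ℤ) < pquot x j).card : ℝ) / n
      + (((Finset.range n).filter fun j => ¬ (a : ℤ) < pquot x j).card : ℝ) / n = 1 := by
    intro n hn
    rw [← add_div, ← Nat.cast_add, Finset.card_filter_add_card_filter_not, Finset.card_range,
      div_self (by exact_mod_cast hn.ne')]
  have hcard' : ∀ (q : ℚ) (n : ℕ),
      (((Finset.range n).filter fun j =>
        (a : ℤ) < pquot x j ∧ medTheta x (pquot x j - a) j ≤ q).card : ℝ) / n +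
      (((Finset.range n).filter fun j =>
        (a : ℤ) < pquot x j ∧ ¬ medTheta x (pquot x j - a) j ≤ q).card : ℝ) / n =
      (((Finset.range n).filter fun j => (a : ℤ) < pquot x j).card : ℝ) / n := by
    intro q n
    rw [← add_div, ← Nat.cast_add, ← Finset.filter_filter, ← Finset.filter_filter,
      Finset.card_filter_add_card_filter_not]
  have hsum : ∀ q : ℚ, gaussNEMeasure.real (mediantLe a q) / gaussNEMeasure.real Set.univ +
      gaussNEMeasure.real (mediantGe a q) / gaussNEMeasure.real Set.univ +
      gaussNEMeasure.real (quotientLe a) / gaussNEMeasure.real Set.univ = 1 := by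
    intro q
    rw [← add_div, ← add_div, gaussNEMeasure_real_mediantLe_add_mediantGe ha, add_comm,
      gaussNEMeasure_real_quotientLe_add, div_self hpos.ne']
  refine ⟨?_, fun q => ?_⟩
  · have h := tendsto_of_eventually_le_of_sum_eq_one k3 (k1 0) (k2 0) (by
      filter_upwards [eventually_gt_atTop 0] with n hn
      rw [add_assoc, hcard', add_comm, hcard n hn]) (by rw [add_assoc, add_comm, hsum])
    have h' := h.const_sub 1
    rw [show 1 - gaussNEMeasure.real (quotientLe a) / gaussNEMeasure.real Set.univ =
      Real.log (((a : ℝ) + 2) / ((a : ℝ) + 1)) / gaussNEMeasure.real Set.univ by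
        rw [← gaussNEMeasure_real_mediantLe_add_mediantGe ha (0 : ℚ), add_div]
        linarith [hsum 0]] at h'
    refine h'.congr' ?_
    filter_upwards [eventually_gt_atTop 0] with n hn
    linarith [hcard n hn]
  · exact tendsto_of_eventually_le_of_sum_eq_one (k1 q) (k2 q) k3 (by
      filter_upwards [eventually_gt_atTop 0] with n hn
      rw [hcard', hcard n hn]) (hsum q)

/-- Bounds and limiting distribution for the approximation coefficients of the mediants
`((a_{j+1} − a) p_j + p_{j−1})/((a_{j+1} − a) q_j + q_{j−1})`, `a_{j+1} > a`. -/
theorem stmt_9 (a : ℕ) (ha : 1 ≤ a) :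
    (∀ x : ℝ, x ∈ Set.Ioo (0:ℝ) 1 → Irrational x → ∀ j : ℕ, (a : ℤ) < pquot x j →
        (a : ℝ) / ((a:ℝ) + 1) < medTheta x (pquot x j - a) j ∧
        medTheta x (pquot x j - a) j < (a:ℝ) + 1) ∧
    ∀ᵐ x ∂(volume : Measure ℝ), x ∈ Set.Ioo (0:ℝ) 1 → Irrational x →
      {j : ℕ | (a : ℤ) < pquot x j}.Infinite ∧
      ∀ z : ℝ, (a:ℝ) / ((a:ℝ) + 1) ≤ z → z ≤ (a:ℝ) + 1 →
        Tendsto (fun n : ℕ =>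
            (((Finset.range n).filter fun k =>
                medTheta x (pquot x (Nat.nth (fun j => (a : ℤ) < pquot x j) k) - a)
                  (Nat.nth (fun j => (a : ℤ) < pquot x j) k) ≤ z).card : ℝ)
              / (n : ℝ))
          atTop (𝓝 (dist9 a z)) := by
  refine ⟨fun x hx hirr j hj => medTheta_bounds ⟨hx, hirr⟩ ha hj, ?_⟩
  have hC := log_add_two_div_add_one_pos a
  have hpos : 0 < gaussNEMeasure.real Set.univ :=
    ENNReal.toReal_pos gaussNEMeasure_univ_ne_zero (measure_ne_top _ _)
  filter_upwards [ae_tendsto_mediant_frequencies ha] with x hx hx01 hirr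
  obtain ⟨hP, hPQ⟩ := hx ⟨hx01, hirr⟩
  refine ⟨infinite_of_tendsto_card_div (div_pos hC hpos) hP, fun z hz hz' => ?_⟩
  rw [dist9_eq ha hz hz']
  refine tendsto_of_monotone_of_tendsto_rat (u := fun n y => (((Finset.range n).filter fun k =>
      medTheta x (pquot x (Nat.nth (fun j => (a : ℤ) < pquot x j) k) - a)
        (Nat.nth (fun j => (a : ℤ) < pquot x j) k) ≤ y).card : ℝ) / n) (fun n y y' hy => ?_)
    ((continuous_gaussNEMeasure_real_mediantLe ha).div_const _) (fun q => ?_) z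
  · beta_reduce
    gcongr
  · have h := tendsto_card_nth_div
      (Q := fun j => medTheta x (pquot x j - a) j ≤ q) (div_pos hC hpos) hP (hPQ q)
    rwa [div_div_div_cancel_right₀ hpos.ne'] at h
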